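/- arXiv:1211.3891 — 4 statements merged into one kernel-verified Lean document; each statement's English description precedes it below -/
import Mathlib

section
/- Deterministic core of Lemma 2.3 (failure of uniform regularity): Let n ≥ 1 and let u : ℤ → ℝ satisfy u(k) ≠ 0 for k ∈ Θ := {0,1,…,n−1} and u(k) = 0 for k ∉ Θ. Set Θᵖ = {k ∈ Θ : u(k) > 0}, u_max = max_{k∈Θ}|u(k)|, u_min = min_{k∈Θ}|u(k)|, s⁺ = ∑_{k∈Θᵖ} u(k); let Θ₁ = {k+1 : k ∈ Θᵖ} if n−1 ∉ Θᵖ, and Θ₁ = ({k+1 : k ∈ Θᵖ} ∩ Θ) ∪ {0} if n−1 ∈ Θᵖ; set m = ∑_{k∈Θ₁} u(k) and c = n·u_max/u_min. Then for every function ω : ℤ → [0,1] and all real numbers δ ≥ δ′ > 0: if both ∑_{k∈Θ} u(k) ω_{−1−k} ∈ [s⁺ − δ′, s⁺] and ∑_{k∈Θ} u(k) ω_{n−1−k} ∈ [s⁺ − δ′, s⁺], then ∑_{k∈Θ} u(k) ω_{−k} ∈ [m − cδ′, m + cδ′] ⊆ [m − cδ, m + cδ]. -/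
/-- If a combination of weights in `[0,1]` is within `ε` of its largest possible value, then every
weight is close to the indicator of the positivity set of its coefficient. -/
lemma abs_mul_abs_sub_ite_le_of_sum_ge {ι : Type*} {s : Finset ι} {a w : ι → ℝ} {ε : ℝ}
    (hw : ∀ i, w i ∈ Set.Icc (0 : ℝ) 1)
    (h : (∑ i ∈ s with 0 < a i, a i) - ε ≤ ∑ i ∈ s, a i * w i) {i : ι} (hi : i ∈ s) :
    |a i| * |w i - if 0 < a i then 1 else 0| ≤ ε := by
  have key (j : ι) : |a j| * |w j - if 0 < a j then 1 else 0| =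
      (if 0 < a j then a j else 0) - a j * w j := by
    obtain ⟨h0, h1⟩ := hw j
    split_ifs with hj
    · rw [abs_of_pos hj, abs_of_nonpos (by linarith)]; ring
    · rw [abs_of_nonpos (not_lt.mp hj), sub_zero, abs_of_nonneg h0]; ring
  calc |a i| * |w i - if 0 < a i then 1 else 0|
      ≤ ∑ j ∈ s, |a j| * |w j - if 0 < a j then 1 else 0| :=
        Finset.single_le_sum (f := fun j => |a j| * |w j - if 0 < a j then 1 else 0|)
          (fun j _ => by positivity) hi
    _ = (∑ j ∈ s with 0 < a j, a j) - ∑ j ∈ s, a j * w j := by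
        simp_rw [key, Finset.sum_sub_distrib, Finset.sum_filter]
    _ ≤ ε := by linarith

/-- **Deterministic core of Lemma 2.3** (failure of uniform regularity): interval arithmetic for
the one-dimensional discrete alloy-type potential `V_ω(x) = ∑_{k∈Θ} u(k) ω_{x-k}` with coupling
constants `ω_k ∈ [0,1]`. -/
theorem stmt_4 (n : ℕ) (hn : 1 ≤ n) (u : ℤ → ℝ)
    (Θ Θp Θ1 : Finset ℤ)
    (hΘ : Θ = Finset.Ico (0 : ℤ) (n : ℤ))
    (hu : ∀ k : ℤ, u k ≠ 0 ↔ k ∈ Θ)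
    (hΘp : Θp = Θ.filter fun k => 0 < u k)
    (umax umin splus m c : ℝ)
    (humax : (∀ k ∈ Θ, |u k| ≤ umax) ∧ ∃ k ∈ Θ, umax = |u k|)
    (humin : (∀ k ∈ Θ, umin ≤ |u k|) ∧ ∃ k ∈ Θ, umin = |u k|)
    (hsplus : splus = ∑ k ∈ Θp, u k)
    (hΘ1 : ((n : ℤ) - 1 ∈ Θp → Θ1 = (Θp.image (· + 1) ∩ Θ) ∪ {0}) ∧
           ((n : ℤ) - 1 ∉ Θp → Θ1 = Θp.image (· + 1)))
    (hm : m = ∑ k ∈ Θ1, u k)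
    (hc : c = n * umax / umin)
    (ω : ℤ → ℝ) (hω : ∀ j : ℤ, ω j ∈ Set.Icc (0 : ℝ) 1)
    (δ δ' : ℝ) (hδ' : 0 < δ') (hδ : δ' ≤ δ)
    (h1 : (∑ k ∈ Θ, u k * ω (-1 - k)) ∈ Set.Icc (splus - δ') splus)
    (h2 : (∑ k ∈ Θ, u k * ω ((n : ℤ) - 1 - k)) ∈ Set.Icc (splus - δ') splus) :
    (∑ k ∈ Θ, u k * ω (-k)) ∈ Set.Icc (m - c * δ') (m + c * δ') ∧
      Set.Icc (m - c * δ') (m + c * δ') ⊆ Set.Icc (m - c * δ) (m + c * δ) := by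
  have humin_pos : 0 < umin := by
    obtain ⟨k, hk, rfl⟩ := humin.2
    exact abs_pos.mpr ((hu k).mpr hk)
  have humax_nonneg : 0 ≤ umax := by
    obtain ⟨k, -, rfl⟩ := humax.2
    exact abs_nonneg _
  have hc0 : 0 ≤ c := by rw [hc]; positivity
  have hmem (k : ℤ) : k ∈ Θp ↔ (0 ≤ k ∧ k < n) ∧ 0 < u k := by
    rw [hΘp, hΘ, Finset.mem_filter, Finset.mem_Ico]
  have hsub : Θ1 ⊆ Θ := by
    intro k hk
    rw [hΘ, Finset.mem_Ico]
    by_cases h : (n : ℤ) - 1 ∈ Θp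
    · rw [hΘ1.1 h, hΘ] at hk
      simp only [Finset.mem_union, Finset.mem_inter, Finset.mem_Ico, Finset.mem_singleton] at hk
      omega
    · rw [hΘ1.2 h, Finset.mem_image] at hk
      obtain ⟨j, hj, rfl⟩ := hk
      have hne : j ≠ (n : ℤ) - 1 := fun e => h (e ▸ hj)
      have := ((hmem j).mp hj).1
      omega
  have hzero : (0 : ℤ) ∈ Θ1 ↔ (n : ℤ) - 1 ∈ Θp := by
    by_cases h : (n : ℤ) - 1 ∈ Θp
    · simp [hΘ1.1 h, h]
    · simp only [hΘ1.2 h, h, iff_false, Finset.mem_image, not_exists, not_and]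
      intro j hj
      have := ((hmem j).mp hj).1
      omega
  have hsucc (k : ℤ) (hk : k ∈ Θ) (hk0 : k ≠ 0) : k ∈ Θ1 ↔ k - 1 ∈ Θp := by
    have himage : k ∈ Θp.image (· + 1) ↔ k - 1 ∈ Θp := by
      simp only [Finset.mem_image]
      exact ⟨by rintro ⟨j, hj, rfl⟩; simpa using hj, fun h => ⟨k - 1, h, by ring⟩⟩
    by_cases h : (n : ℤ) - 1 ∈ Θp
    · rw [hΘ1.1 h, Finset.mem_union, Finset.mem_inter, himage, Finset.mem_singleton]
      tauto
    · rw [hΘ1.2 h, himage]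
  have close (x k : ℤ) (hk : k ∈ Θ)
      (h : splus - δ' ≤ ∑ k ∈ Θ, u k * ω (x - k)) :
      umin * |ω (x - k) - if k ∈ Θp then 1 else 0| ≤ δ' := by
    rw [hsplus, hΘp] at h
    have := abs_mul_abs_sub_ite_le_of_sum_ge (fun k => hω (x - k)) h hk
    simp only [hΘp, Finset.mem_filter, hk, true_and]
    exact (mul_le_mul_of_nonneg_right (humin.1 k hk) (abs_nonneg _)).trans this
  have close_zero (k : ℤ) (hk : k ∈ Θ) :
      umin * |ω (-k) - if k ∈ Θ1 then 1 else 0| ≤ δ' := by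
    have hk' := hk
    rw [hΘ, Finset.mem_Ico] at hk'
    rcases eq_or_ne k 0 with rfl | hk0
    · have := close (n - 1) (n - 1) (by rw [hΘ, Finset.mem_Ico]; omega) h2.1
      simpa [hzero] using this
    · have := close (-1) (k - 1) (by rw [hΘ, Finset.mem_Ico]; omega) h1.1
      rw [show -1 - (k - 1) = -k by ring] at this
      simpa only [hsucc k hk hk0] using this
  have hm' : m = ∑ k ∈ Θ, u k * if k ∈ Θ1 then 1 else 0 := by
    simp only [mul_ite, mul_one, mul_zero]
    rw [hm, ← Finset.sum_filter, Finset.filter_mem_eq_inter, Finset.inter_eq_right.mpr hsub]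
  have main : |(∑ k ∈ Θ, u k * ω (-k)) - m| ≤ c * δ' := by
    rw [hm', ← Finset.sum_sub_distrib]
    calc |∑ k ∈ Θ, (u k * ω (-k) - u k * if k ∈ Θ1 then 1 else 0)|
        ≤ ∑ k ∈ Θ, |u k * ω (-k) - u k * if k ∈ Θ1 then 1 else 0| :=
          Finset.abs_sum_le_sum_abs _ _
      _ ≤ ∑ _k ∈ Θ, umax * (δ' / umin) := by
          refine Finset.sum_le_sum fun k hk => ?_
          rw [← mul_sub, abs_mul]
          refine mul_le_mul (humax.1 k hk) ?_ (abs_nonneg _) humax_nonneg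
          rw [le_div_iff₀' humin_pos]
          exact close_zero k hk
      _ = c * δ' := by
          rw [Finset.sum_const, hΘ, Int.card_Ico, hc, nsmul_eq_mul, sub_zero, Int.toNat_natCast]
          ring
  have hle : c * δ' ≤ c * δ := mul_le_mul_of_nonneg_left hδ hc0
  rw [abs_le] at main
  exact ⟨⟨by linarith, by linarith⟩, Set.Icc_subset_Icc (by linarith) (by linarith)⟩
end

section
/- Characterization of single-site potentials admitting a positive linear combination of translates (Lemma 3.17): Let n ≥ 1 and let u : ℤ → ℝ satisfy u(k) = 0 for k ∉ {0,1,…,n−1}, u(0) ≠ 0 and u(n−1) ≠ 0. For j ∈ ℤ write u_j(x) = u(x−j). Then the following are equivalent: (a) there exist an integer N ≥ 0 and real numbers α₀,…,α_N such that w := α₀u₀ + ⋯ + α_N u_N satisfies w(x) ≥ 0 for all x ∈ ℤ, w(0) > 0 and w(N+n−1) > 0; (b) there exist an integer M ≥ 0 and real numbers γ₀,…,γ_M such that v := γ₀u₀ + ⋯ + γ_M u_M satisfies v(x) ≥ 0 for all x ∈ ℤ and supp v = {0,1,…,M+n−1}; (c) the polynomial p_u(x) = ∑_{k=0}^{n−1}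 u(k) x^k has no root in [0,∞), i.e. p_u(x) ≠ 0 for every real x ≥ 0. -/
open Polynomial in
/-- The coefficients of `p` in degrees `0, …, d` are positive and all others vanish. -/
def Polynomial.PosUpTo (d : ℕ) (p : ℝ[X]) : Prop :=
  (∀ i ≤ d, 0 < p.coeff i) ∧ ∀ i, d < i → p.coeff i = 0

open Polynomial in
/-- Some multiple of `p` has positive coefficients in all degrees up to its own degree. -/
def Polynomial.HasPosMultiple (p : ℝ[X]) : Prop :=
  ∃ (A : ℝ[X]) (d : ℕ), (A * p).PosUpTo d

namespace Polynomial

theorem PosUpTo.coeff_nonneg {d : ℕ} {p : ℝ[X]} (h : p.PosUpTo d) (i : ℕ) : 0 ≤ p.coeff i := by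
  rcases le_or_gt i d with hi | hi
  · exact (h.1 i hi).le
  · exact (h.2 i hi).ge

theorem PosUpTo.natDegree_eq {d : ℕ} {p : ℝ[X]} (h : p.PosUpTo d) : p.natDegree = d :=
  le_antisymm (natDegree_le_iff_coeff_eq_zero.2 fun i hi => h.2 i hi)
    (le_natDegree_of_ne_zero (h.1 d le_rfl).ne')

theorem PosUpTo.ne_zero {d : ℕ} {p : ℝ[X]} (h : p.PosUpTo d) : p ≠ 0 := by
  rintro rfl
  simpa using h.1 0 (Nat.zero_le d)

theorem PosUpTo.mul {d e : ℕ} {p q : ℝ[X]} (hp : p.PosUpTo d) (hq : q.PosUpTo e) :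
    (p * q).PosUpTo (d + e) := by
  refine ⟨fun i hi => ?_, fun i hi => ?_⟩
  · rw [coeff_mul]
    refine Finset.sum_pos' (fun x _ => mul_nonneg (hp.coeff_nonneg _) (hq.coeff_nonneg _))
      ⟨(min i d, i - min i d), ?_, ?_⟩
    · rw [Finset.HasAntidiagonal.mem_antidiagonal]
      omega
    · exact mul_pos (hp.1 _ (by omega)) (hq.1 _ (by omega))
  · rw [coeff_mul]
    refine Finset.sum_eq_zero fun x hx => ?_
    rw [Finset.HasAntidiagonal.mem_antidiagonal] at hx
    rcases le_or_gt x.1 d with h | h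
    · rw [hq.2 x.2 (by omega), mul_zero]
    · rw [hp.2 x.1 h, zero_mul]

theorem PosUpTo.one_add_X_mul_expand_two {d : ℕ} {p : ℝ[X]} (hp : p.PosUpTo d) :
    ((1 + X) * expand ℝ 2 p).PosUpTo (2 * d + 1) := by
  have even_coeff (m : ℕ) : ((1 + X) * expand ℝ 2 p).coeff (2 * m) = p.coeff m := by
    rw [add_mul, one_mul, coeff_add, coeff_expand_mul' two_pos]
    cases m with
    | zero => simp
    | succ m =>
      rw [show 2 * (m + 1) = (2 * m + 1) + 1 by ring, coeff_X_mul, coeff_expand two_pos,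
        if_neg (by omega), add_zero]
  have odd_coeff (m : ℕ) : ((1 + X) * expand ℝ 2 p).coeff (2 * m + 1) = p.coeff m := by
    rw [add_mul, one_mul, coeff_add, coeff_X_mul, coeff_expand_mul' two_pos,
      coeff_expand two_pos, if_neg (by omega), zero_add]
  refine ⟨fun i hi => ?_, fun i hi => ?_⟩ <;> obtain ⟨m, rfl | rfl⟩ := i.even_or_odd'
  · rw [even_coeff]; exact hp.1 m (by omega)
  · rw [odd_coeff]; exact hp.1 m (by omega)
  · rw [even_coeff]; exact hp.2 m (by omega)
  · rw [odd_coeff]; exact hp.2 m (by omega)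

theorem HasPosMultiple.mul {p q : ℝ[X]} (hp : p.HasPosMultiple) (hq : q.HasPosMultiple) :
    (p * q).HasPosMultiple := by
  obtain ⟨A, d, hA⟩ := hp
  obtain ⟨B, e, hB⟩ := hq
  exact ⟨A * B, d + e, by rw [mul_mul_mul_comm]; exact hA.mul hB⟩

theorem hasPosMultiple_C {a : ℝ} (ha : a ≠ 0) : (C a).HasPosMultiple := by
  refine ⟨C a⁻¹, 0, ?_⟩
  rw [← C_mul, inv_mul_cancel₀ ha]
  refine ⟨fun i hi => ?_, fun i hi => ?_⟩
  · simp [Nat.le_zero.1 hi]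
  · rw [coeff_C, if_neg (by omega)]

theorem hasPosMultiple_X_add_C {a : ℝ} (ha : 0 < a) : (X + C a).HasPosMultiple := by
  refine ⟨1, 1, ?_⟩
  rw [one_mul]
  refine ⟨fun i hi => ?_, fun i hi => ?_⟩
  · interval_cases i <;> simp [ha]
  · rw [coeff_add, coeff_X, coeff_C, if_neg (by omega), if_neg (by omega), add_zero]

theorem exists_pow_lt_pow_mul_centralBinom {s c : ℝ} (hs : 0 ≤ s) (h : s < 4 * c) :
    ∃ k : ℕ, s ^ k < c ^ k * k.centralBinom := by
  have hc : 0 < 4 * c := hs.trans_lt h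
  have hr : s / (4 * c) < 1 := (div_lt_one hc).2 h
  have hlim := tendsto_self_mul_const_pow_of_lt_one (div_nonneg hs hc.le) hr
  obtain ⟨k, hk, hk0⟩ := ((hlim.eventually (gt_mem_nhds (by norm_num : (0 : ℝ) < 1 / 2))).and
    (Filter.eventually_gt_atTop 0)).exists
  refine ⟨k, ?_⟩
  have hk' : (0 : ℝ) < k := by exact_mod_cast hk0
  have hbinom : (4 : ℝ) ^ k ≤ 2 * k * k.centralBinom := by
    exact_mod_cast Nat.four_pow_le_two_mul_self_mul_centralBinom k hk0
  have hck : 0 < c ^ k := pow_pos (by linarith) k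
  rw [div_pow, mul_div_assoc', div_lt_iff₀ (pow_pos hc k), mul_pow] at hk
  have hmul := mul_le_mul_of_nonneg_right hbinom hck.le
  refine lt_of_mul_lt_mul_left (a := (k : ℝ)) ?_ hk'.le
  nlinarith

theorem hasPosMultiple_quadratic {b c : ℝ} (h : b ^ 2 < 4 * c) :
    (X ^ 2 + C b * X + C c).HasPosMultiple := by
  have hc : 0 < c := by nlinarith [sq_nonneg b]
  obtain ⟨k, hk⟩ := exists_pow_lt_pow_mul_centralBinom (sq_nonneg b) h
  set R : ℝ[X] := (X + C c) ^ (2 * k) - C (b ^ (2 * k)) * X ^ k with hR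
  have hcoeff (i : ℕ) : R.coeff i =
      c ^ (2 * k - i) * (2 * k).choose i - if i = k then b ^ (2 * k) else 0 := by
    rw [hR, coeff_sub, coeff_X_add_C_pow, coeff_C_mul_X_pow]
  have hRpos : R.PosUpTo (2 * k) := by
    refine ⟨fun i hi => ?_, fun i hi => ?_⟩
    · rw [hcoeff]
      split_ifs with hik
      · subst hik
        rw [show 2 * i - i = i by omega, pow_mul, sub_pos]
        exact hk
      · rw [sub_zero]
        exact mul_pos (pow_pos hc _) (by exact_mod_cast Nat.choose_pos hi)
    · rw [hcoeff, Nat.choose_eq_zero_of_lt hi, if_neg (by omega)]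
      simp
  have hexp : expand ℝ 2 R = (X ^ 2 + C c) ^ (2 * k) - (-(C b * X)) ^ (2 * k) := by
    rw [(even_two_mul k).neg_pow, hR]
    simp only [map_sub, map_mul, map_pow, map_add, expand_X, expand_C, mul_pow, ← pow_mul]
  have hdvd : X ^ 2 + C b * X + C c ∣ expand ℝ 2 R := by
    rw [hexp]
    convert sub_dvd_pow_sub_pow (X ^ 2 + C c) (-(C b * X)) (2 * k) using 1
    ring
  obtain ⟨S, hS⟩ := hdvd
  refine ⟨(1 + X) * S, 2 * (2 * k) + 1, ?_⟩
  rw [mul_assoc, mul_comm S, ← hS]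
  exact hRpos.one_add_X_mul_expand_two

theorem hasPosMultiple_of_monic_of_irreducible {p : ℝ[X]} (hm : p.Monic) (hp : Irreducible p)
    (hroot : ∀ x : ℝ, 0 ≤ x → p.eval x ≠ 0) : p.HasPosMultiple := by
  have hdeg := hp.natDegree_le_two
  have hpos := hp.natDegree_pos
  have hlead : p.coeff p.natDegree = 1 := hm
  obtain hd | hd : p.natDegree = 1 ∨ p.natDegree = 2 := by omega
  · rw [hm.eq_X_add_C hd] at hroot ⊢
    refine hasPosMultiple_X_add_C ?_
    by_contra! hle
    exact hroot (-p.coeff 0) (by linarith) (by simp)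
  · rw [hd] at hlead
    have hform : p = X ^ 2 + C (p.coeff 1) * X + C (p.coeff 0) := by
      conv_lhs => rw [p.as_sum_range_C_mul_X_pow, hd]
      simp only [Finset.sum_range_succ, Finset.sum_range_zero, hlead, map_one]
      ring
    rw [hform]
    refine hasPosMultiple_quadratic ?_
    by_contra! hle
    set b := p.coeff 1
    set c := p.coeff 0
    refine hp.not_isRoot_of_natDegree_ne_one (by omega) (x := (-b + √(b ^ 2 - 4 * c)) / 2) ?_
    rw [IsRoot, hform]
    simp only [eval_add, eval_pow, eval_X, eval_mul, eval_C]
    nlinarith [Real.sq_sqrt (sub_nonneg.2 hle)]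

theorem hasPosMultiple_of_eval_ne_zero (p : ℝ[X]) :
    (∀ x : ℝ, 0 ≤ x → p.eval x ≠ 0) → p.HasPosMultiple := by
  induction p using UniqueFactorizationMonoid.induction_on_prime with
  | h₁ => exact fun h => absurd eval_zero (h 0 le_rfl)
  | h₂ p hp =>
    obtain ⟨a, ha, rfl⟩ := isUnit_iff.1 hp
    exact fun _ => hasPosMultiple_C ha.ne_zero
  | h₃ a p _ hp ih =>
    intro h
    simp only [eval_mul, mul_ne_zero_iff] at h
    refine HasPosMultiple.mul ?_ (ih fun x hx => (h x hx).2)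
    have hl : p.leadingCoeff ≠ 0 := leadingCoeff_ne_zero.2 hp.ne_zero
    have hfac : p = C p.leadingCoeff * (p * C p.leadingCoeff⁻¹) := by
      rw [mul_left_comm, ← C_mul, mul_inv_cancel₀ hl, C_1, mul_one]
    rw [hfac]
    refine (hasPosMultiple_C hl).mul (hasPosMultiple_of_monic_of_irreducible
      (monic_mul_leadingCoeff_inv hp.ne_zero)
      (irreducible_mul_leadingCoeff_inv.2 hp.irreducible) fun x hx => ?_)
    rw [eval_mul, eval_C]
    exact mul_ne_zero (h x hx).1 (inv_ne_zero hl)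

theorem coeff_sum_C_mul_X_pow_range (n : ℕ) (f : ℕ → ℝ) (i : ℕ) :
    (∑ k ∈ Finset.range n, C (f k) * X ^ k).coeff i = if i < n then f i else 0 := by
  simp

/-- If `p` has coefficient sequence `u`, then multiplying `p` by a polynomial corresponds to
combining translates of `u`. -/
theorem coeff_sum_C_mul_X_pow_mul {u : ℤ → ℝ} (hu : ∀ k < 0, u k = 0) {p : ℝ[X]}
    (hp : ∀ i : ℕ, p.coeff i = u i) (N : ℕ) (α : ℕ → ℝ) (m : ℕ) :
    ((∑ j ∈ Finset.range N, C (α j) * X ^ j) * p).coeff m =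
      ∑ j ∈ Finset.range N, α j * u ((m : ℤ) - j) := by
  rw [Finset.sum_mul, finsetSum_coeff]
  refine Finset.sum_congr rfl fun j _ => ?_
  rw [mul_assoc, coeff_C_mul, coeff_X_pow_mul']
  split_ifs with hj
  · rw [hp, Nat.cast_sub hj]
  · rw [hu _ (by omega)]

theorem eval_pos_of_coeff_nonneg {p : ℝ[X]} (h : ∀ i, 0 ≤ p.coeff i) (h0 : 0 < p.coeff 0)
    {x : ℝ} (hx : 0 ≤ x) : 0 < p.eval x := by
  rw [eval_eq_sum_range]
  exact Finset.sum_pos' (fun i _ => mul_nonneg (h i) (pow_nonneg hx i))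
    ⟨0, by simp, by simpa using h0⟩

end Polynomial


/-- **Characterization of single-site potentials admitting a positive linear combination of
translates** (Lemma 3.17): for a single-site potential `u` supported in `{0,…,n-1}` with
`u 0 ≠ 0` and `u (n-1) ≠ 0`, conditions (a), (b), (c) are equivalent. -/
theorem stmt_6 (n : ℕ) (hn : 1 ≤ n) (u : ℤ → ℝ)
    (hsupp : ∀ k : ℤ, u k ≠ 0 → 0 ≤ k ∧ k ≤ (n : ℤ) - 1)
    (h0 : u 0 ≠ 0) (hn1 : u ((n : ℤ) - 1) ≠ 0) :
    ((∃ (N : ℕ) (α : ℕ → ℝ),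
        (∀ x : ℤ, 0 ≤ ∑ j ∈ Finset.range (N + 1), α j * u (x - (j : ℤ))) ∧
        (0 < ∑ j ∈ Finset.range (N + 1), α j * u ((0 : ℤ) - (j : ℤ))) ∧
        (0 < ∑ j ∈ Finset.range (N + 1), α j * u (((N : ℤ) + (n : ℤ) - 1) - (j : ℤ)))) ↔
      (∃ (M : ℕ) (γ : ℕ → ℝ),
        (∀ x : ℤ, 0 ≤ ∑ j ∈ Finset.range (M + 1), γ j * u (x - (j : ℤ))) ∧
        (∀ x : ℤ, (∑ j ∈ Finset.range (M + 1), γ j * u (x - (j : ℤ))) ≠ 0 ↔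
          0 ≤ x ∧ x ≤ (M : ℤ) + (n : ℤ) - 1))) ∧
    ((∃ (M : ℕ) (γ : ℕ → ℝ),
        (∀ x : ℤ, 0 ≤ ∑ j ∈ Finset.range (M + 1), γ j * u (x - (j : ℤ))) ∧
        (∀ x : ℤ, (∑ j ∈ Finset.range (M + 1), γ j * u (x - (j : ℤ))) ≠ 0 ↔
          0 ≤ x ∧ x ≤ (M : ℤ) + (n : ℤ) - 1)) ↔
      (∀ x : ℝ, 0 ≤ x → (∑ k ∈ Finset.range n, u (k : ℤ) * x ^ k) ≠ 0)) := by
  have hneg (k : ℤ) (hk : k < 0) : u k = 0 := by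
    by_contra h
    have := hsupp k h
    omega
  set p : Polynomial ℝ :=
    ∑ k ∈ Finset.range n, Polynomial.C (u (k : ℤ)) * Polynomial.X ^ k with hpdef
  have hp (i : ℕ) : p.coeff i = u i := by
    rw [hpdef, Polynomial.coeff_sum_C_mul_X_pow_range n (fun k => u (k : ℤ))]
    split_ifs with hi
    · rfl
    · by_contra h
      have := hsupp i (Ne.symm h)
      omega
  have heval (x : ℝ) : p.eval x = ∑ k ∈ Finset.range n, u (k : ℤ) * x ^ k := by
    simp [hpdef, Polynomial.eval_finsetSum]
  have hpdeg : p.natDegree = n - 1 := by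
    refine le_antisymm (Polynomial.natDegree_le_iff_coeff_eq_zero.2 fun i hi => ?_)
      (Polynomial.le_natDegree_of_ne_zero ?_)
    · rw [hp]
      by_contra h
      have := hsupp i h
      omega
    · rw [hp]
      convert hn1 using 2
      omega
  have hp0 : p ≠ 0 := by
    rintro h
    exact h0 (by simpa [h] using (hp 0).symm)
  simp only [← heval]
  have ba : (∃ (M : ℕ) (γ : ℕ → ℝ),
        (∀ x : ℤ, 0 ≤ ∑ j ∈ Finset.range (M + 1), γ j * u (x - (j : ℤ))) ∧
        (∀ x : ℤ, (∑ j ∈ Finset.range (M + 1), γ j * u (x - (j : ℤ))) ≠ 0 ↔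
          0 ≤ x ∧ x ≤ (M : ℤ) + (n : ℤ) - 1)) →
      ∃ (N : ℕ) (α : ℕ → ℝ),
        (∀ x : ℤ, 0 ≤ ∑ j ∈ Finset.range (N + 1), α j * u (x - (j : ℤ))) ∧
        (0 < ∑ j ∈ Finset.range (N + 1), α j * u ((0 : ℤ) - (j : ℤ))) ∧
        (0 < ∑ j ∈ Finset.range (N + 1), α j * u (((N : ℤ) + (n : ℤ) - 1) - (j : ℤ))) := by
    rintro ⟨M, γ, hnn, hs⟩
    exact ⟨M, γ, hnn, (hnn _).lt_of_ne' ((hs _).2 (by omega)),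
      (hnn _).lt_of_ne' ((hs _).2 (by omega))⟩
  have ac : (∃ (N : ℕ) (α : ℕ → ℝ),
        (∀ x : ℤ, 0 ≤ ∑ j ∈ Finset.range (N + 1), α j * u (x - (j : ℤ))) ∧
        (0 < ∑ j ∈ Finset.range (N + 1), α j * u ((0 : ℤ) - (j : ℤ))) ∧
        (0 < ∑ j ∈ Finset.range (N + 1), α j * u (((N : ℤ) + (n : ℤ) - 1) - (j : ℤ)))) →
      ∀ x : ℝ, 0 ≤ x → p.eval x ≠ 0 := by
    rintro ⟨N, α, hnn, hpos, -⟩ x hx hzero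
    have hcoeff := Polynomial.coeff_sum_C_mul_X_pow_mul hneg hp (N + 1) α
    have := Polynomial.eval_pos_of_coeff_nonneg (fun i => (hnn i).trans_eq (hcoeff i).symm)
      (hpos.trans_eq (hcoeff 0).symm) hx
    rw [Polynomial.eval_mul, hzero, mul_zero] at this
    exact this.false
  have cb : (∀ x : ℝ, 0 ≤ x → p.eval x ≠ 0) → ∃ (M : ℕ) (γ : ℕ → ℝ),
        (∀ x : ℤ, 0 ≤ ∑ j ∈ Finset.range (M + 1), γ j * u (x - (j : ℤ))) ∧
        (∀ x : ℤ, (∑ j ∈ Finset.range (M + 1), γ j * u (x - (j : ℤ))) ≠ 0 ↔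
          0 ≤ x ∧ x ≤ (M : ℤ) + (n : ℤ) - 1) := by
    intro h
    obtain ⟨A, d, hA⟩ := p.hasPosMultiple_of_eval_ne_zero h
    have hd : d = A.natDegree + (n - 1) := by
      rw [← hA.natDegree_eq, Polynomial.natDegree_mul (left_ne_zero_of_mul hA.ne_zero) hp0, hpdeg]
    have hcoeff (m : ℕ) := Polynomial.coeff_sum_C_mul_X_pow_mul hneg hp (A.natDegree + 1) A.coeff m
    rw [← A.as_sum_range_C_mul_X_pow] at hcoeff
    have hsum_neg (x : ℤ) (hx : x < 0) :
        ∑ j ∈ Finset.range (A.natDegree + 1), A.coeff j * u (x - (j : ℤ)) = 0 :=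
      Finset.sum_eq_zero fun j _ => by rw [hneg _ (by omega), mul_zero]
    refine ⟨A.natDegree, A.coeff, fun x => ?_, fun x => ?_⟩ <;> rcases lt_or_ge x 0 with hx | hx
    · exact (hsum_neg x hx).ge
    · lift x to ℕ using hx
      exact (hA.coeff_nonneg x).trans_eq (hcoeff x)
    · simp only [hsum_neg x hx, ne_eq, not_true, false_iff]
      omega
    · lift x to ℕ using hx
      rw [← hcoeff]
      refine ⟨fun hne => ?_, fun hx => (hA.1 x (by omega)).ne'⟩
      by_contra hx
      exact hne (hA.2 x (by omega))
  exact ⟨⟨cb ∘ ac, ba⟩, ac ∘ ba, cb⟩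
end

section
/- Abstract Wegner estimate (Theorem 4.1): Consider the discrete alloy-type model and assume ν has a probability density ρ of finite total variation. Let l ∈ ℕ and suppose that for every j ∈ Λ_l there is a finitely supported function t_j : ℤ^d → ℝ such that ∑_{k∈ℤ^d} t_j(k) u(x−k) ≥ δ_j(x) for all x ∈ Λ_l, where δ_j(x) = 1 if x = j and 0 otherwise. Then for every bounded interval I = [E₁, E₂] ⊂ ℝ one has 𝔼( Tr χ_I(H_{Λ_l}) ) ≤ (1/(2λ)) ‖ρ‖_Var |I| ∑_{j∈Λ_l} ‖t_j‖_{ℓ¹}, where |I| = E₂ − E₁ and ‖t_j‖_{ℓ¹} = ∑_{k∈ℤ^d} |t_j(k)|. -/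
open MeasureTheory
open scoped ENNReal

noncomputable section

/-- The cube `Λ_{L,k} = {x ∈ ℤ^d : |x-k|_∞ ≤ L}` as a finite set. -/
def cube {d : ℕ} (L : ℕ) (k : Fin d → ℤ) : Finset (Fin d → ℤ) :=
  Fintype.piFinset fun i => Finset.Icc (k i - L) (k i + L)

/-- The `ℓ¹` distance on `ℤ^d`. -/
def dist1 {d : ℕ} (x y : Fin d → ℤ) : ℕ := ∑ i, (x i - y i).natAbs

/-- The alloy-type random potential `V_ω(x) = ∑_{k∈ℤ^d} ω_k u(x-k)`. -/
def potential {d : ℕ} (u ω : (Fin d → ℤ) → ℝ) (x : Fin d → ℤ) : ℝ :=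
  ∑' k : Fin d → ℤ, ω k * u (x - k)

/-- The finite-volume discrete alloy-type Hamiltonian `H_Λ = -Δ_Λ + λ V_Λ`. -/
def hamiltonian {d : ℕ} (lam : ℝ) (u ω : (Fin d → ℤ) → ℝ)
    (Λ : Finset (Fin d → ℤ)) : Matrix Λ Λ ℝ :=
  Matrix.of fun x y =>
    if dist1 (x : Fin d → ℤ) (y : Fin d → ℤ) = 1 then -1
    else if x = y then lam * potential u ω (x : Fin d → ℤ)
    else 0

/-- The finite-volume Green function `G_Λ(z) = (H_Λ - z)⁻¹` at complex energy `z`. -/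
def green {d : ℕ} (lam : ℝ) (u ω : (Fin d → ℤ) → ℝ) (Λ : Finset (Fin d → ℤ))
    (z : ℂ) : Matrix Λ Λ ℂ :=
  ((hamiltonian lam u ω Λ).map (fun a => (a : ℂ)) - z • (1 : Matrix Λ Λ ℂ))⁻¹

/-- `Tr χ_I(H)`: the number of eigenvalues (with multiplicity) of the real symmetric matrix `H`
lying in the set `I`. -/
def eigCount {m : Type*} [Fintype m] [DecidableEq m] (H : Matrix m m ℝ) (I : Set ℝ) : ℕ :=
  if hH : H.IsHermitian then Nat.card {i // hH.eigenvalues i ∈ I} else 0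

/-- `P` is the product measure `⊗_{k∈ℤ^d} ν`, characterized on finite cylinder sets. -/
def IsProductOf {d : ℕ} (P : Measure ((Fin d → ℤ) → ℝ)) (ν : Measure ℝ) : Prop :=
  ∀ (S : Finset (Fin d → ℤ)) (B : (Fin d → ℤ) → Set ℝ),
    (∀ k ∈ S, MeasurableSet (B k)) →
      P {ω | ∀ k ∈ S, ω k ∈ B k} = ∏ k ∈ S, ν (B k)

/-- The set of values `∫ f v'` over test functions `v ∈ C_c^∞(ℝ)` with `|v| ≤ 1`. -/
def varSet (f : ℝ → ℝ) : Set ℝ :=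
  (fun v : ℝ → ℝ => ∫ x, f x * deriv v x) ''
    {v | ContDiff ℝ (⊤ : ℕ∞) v ∧ HasCompactSupport v ∧ ∀ x, |v x| ≤ 1}

/-- The total variation norm `‖f‖_Var = sup {∫ f v' : v ∈ C_c^∞(ℝ), |v| ≤ 1}`. -/
def varNorm (f : ℝ → ℝ) : ℝ := sSup (varSet f)


lemma zero_mem_varSet (f : ℝ → ℝ) : 0 ∈ varSet f :=
  ⟨fun _ => 0, ⟨contDiff_const, HasCompactSupport.zero, by simp⟩, by simp⟩

lemma varNorm_nonneg {f : ℝ → ℝ} (hf : BddAbove (varSet f)) : 0 ≤ varNorm f :=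
  le_csSup hf (zero_mem_varSet f)

/-- Translation estimate for a function of bounded variation, tested on smooth functions. -/
lemma integral_mul_translate_sub_le_of_contDiff {ρ : ℝ → ℝ} (hρ : BddAbove (varSet ρ))
    {g : ℝ → ℝ} (hg : ContDiff ℝ (⊤ : ℕ∞) g) (hgc : HasCompactSupport g) {M : ℝ} (hM : 0 < M)
    (hgM : ∀ x, |g x| ≤ M) (a : ℝ) :
    ∫ x, ρ x * (g (x + a) - g x) ≤ M * |a| * varNorm ρ := by
  rcases eq_or_ne a 0 with rfl | ha
  · simp
  have hc : 0 < M * |a| := mul_pos hM (abs_pos.mpr ha)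
  set c := M * |a| with hcdef
  have hint : ∀ x y, IntervalIntegrable g volume x y := fun x y =>
    hg.continuous.intervalIntegrable x y
  set v : ℝ → ℝ := fun x => c⁻¹ * ∫ y in x..(x + a), g y with hv
  have hderiv : ∀ x, HasDerivAt v (c⁻¹ * (g (x + a) - g x)) x := by
    intro x
    have hG : ∀ y, HasDerivAt (fun z => ∫ w in (0 : ℝ)..z, g w) (g y) y := fun y =>
      hg.continuous.integral_hasStrictDerivAt 0 y |>.hasDerivAt
    have h1 : HasDerivAt (fun x => ∫ w in (0 : ℝ)..(x + a), g w) (g (x + a)) x :=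
      (hG (x + a)).comp_add_const x a
    have h2 := (h1.sub (hG x)).const_mul c⁻¹
    refine h2.congr_of_eventuallyEq (Filter.Eventually.of_forall fun y => ?_)
    simp only [hv, Pi.sub_apply]
    rw [intervalIntegral.integral_interval_sub_left (hint _ _) (hint _ _)]
  have hdv : deriv v = fun x => c⁻¹ * (g (x + a) - g x) := funext fun x => (hderiv x).deriv
  have hmem : c⁻¹ * ∫ x, ρ x * (g (x + a) - g x) ∈ varSet ρ := by
    refine ⟨v, ⟨?_, ?_, ?_⟩, ?_⟩
    · refine contDiff_infty_iff_deriv.mpr ⟨fun x => (hderiv x).differentiableAt, ?_⟩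
      rw [hdv]
      fun_prop
    · obtain ⟨B, hB⟩ := hgc.isCompact.isBounded.subset_closedBall 0
      refine HasCompactSupport.intro (isCompact_closedBall (0 : ℝ) (B + |a|)) fun x hx => ?_
      have hx' : B + |a| < |x| := by simpa using hx
      have : ∫ y in x..(x + a), g y = ∫ y in x..(x + a), (0 : ℝ) := by
        refine intervalIntegral.integral_congr fun y hy => ?_
        have h1 : |y - x| ≤ |a| := by
          have := Set.abs_sub_left_of_mem_uIcc hy
          simpa using this
        by_contra hne
        have h2 := hB (subset_tsupport g hne)
        rw [mem_closedBall_zero_iff, Real.norm_eq_abs] at h2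
        have h3 := abs_sub_abs_le_abs_sub x y
        rw [abs_sub_comm] at h3
        linarith
      simp [hv, this]
    · intro x
      have h1 : ‖∫ y in x..(x + a), g y‖ ≤ M * |x + a - x| :=
        intervalIntegral.norm_integral_le_of_norm_le_const fun y _ => hgM y
      rw [hv]
      simp only [abs_mul, abs_inv, abs_of_pos hc]
      rw [inv_mul_le_iff₀ hc, mul_one]
      simpa using h1
    · simp only [hdv]
      rw [← integral_const_mul]
      congr 1
      ext x
      ring
  have := le_csSup hρ hmem
  rw [inv_mul_le_iff₀ hc] at this
  exact this

/-- Translation estimate for a probability density of bounded variation, tested on bounded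
measurable functions. -/
lemma integral_translate_sub_le {ρ : ℝ → ℝ} (hρ_nonneg : ∀ x, 0 ≤ ρ x) (hρ_int : Integrable ρ)
    (hρ : BddAbove (varSet ρ)) {ν : Measure ℝ}
    (hν : ν = volume.withDensity fun x => ENNReal.ofReal (ρ x)) [IsProbabilityMeasure ν]
    {ψ : ℝ → ℝ} (hψ : Measurable ψ) {M : ℝ} (hM : 0 < M) (hψM : ∀ x, |ψ x| ≤ M) (a : ℝ) :
    ∫ x, ψ (x + a) ∂ν - ∫ x, ψ x ∂ν ≤ M * |a| * varNorm ρ := by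
  have hV := varNorm_nonneg hρ
  refine le_of_forall_pos_le_add fun η hη => ?_
  obtain ⟨δ, hδ, hδη⟩ : ∃ δ > 0, (3 + |a| * varNorm ρ) * δ ≤ η := by
    have : 0 < 3 + |a| * varNorm ρ := by positivity
    exact ⟨η / (3 + |a| * varNorm ρ), by positivity, by field_simp; rfl⟩
  have hT : Measurable fun x : ℝ => x + a := by fun_prop
  let μ : Measure ℝ := ν + ν.map (fun x => x + a)
  have : IsProbabilityMeasure (ν.map fun x => x + a) :=
    Measure.isProbabilityMeasure_map hT.aemeasurable
  have hψμ : Integrable ψ μ := Integrable.of_bound hψ.aestronglyMeasurable M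
    (Filter.Eventually.of_forall hψM)
  obtain ⟨g₀, hg₀c, hg₀δ, hg₀cont, hg₀int⟩ :=
    hψμ.exists_hasCompactSupport_integral_sub_le hδ
  let g₁ : ℝ → ℝ := fun x => max (-M) (min M (g₀ x))
  have hg₁cont : Continuous g₁ := by fun_prop
  have hg₁c : HasCompactSupport g₁ := by
    refine hg₀c.comp_left (g := fun y => max (-M) (min M y)) ?_
    simp [hM.le]
  have hg₁M : ∀ x, |g₁ x| ≤ M := fun x =>
    abs_le.mpr ⟨le_max_left _ _, max_le (by linarith) (min_le_left _ _)⟩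
  have hg₁le : ∀ x, |ψ x - g₁ x| ≤ |ψ x - g₀ x| := by
    intro x
    have h := abs_le.mp (hψM x)
    have hcl : ψ x = max (-M) (min M (ψ x)) := by
      rw [min_eq_right h.2, max_eq_right h.1]
    conv_lhs => rw [hcl]
    calc |max (-M) (min M (ψ x)) - max (-M) (min M (g₀ x))|
        ≤ max |(-M) - (-M)| |min M (ψ x) - min M (g₀ x)| := abs_max_sub_max_le_max _ _ _ _
      _ = |min M (ψ x) - min M (g₀ x)| := by simp
      _ ≤ max |M - M| |ψ x - g₀ x| := abs_min_sub_min_le_max _ _ _ _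
      _ = |ψ x - g₀ x| := by simp
  obtain ⟨g, hg, hgδ, hgs⟩ := hg₁cont.exists_contDiff_approx ⊤ (ε := fun _ => δ) (by fun_prop)
      (fun _ => hδ)
  have hgc : HasCompactSupport g := hg₁c.mono hgs
  have hgM : ∀ x, |g x| ≤ M + δ := by
    intro x
    have h1 := hgδ x
    have h2 := hg₁M x
    rw [Real.dist_eq] at h1
    have := abs_sub_abs_le_abs_sub (g x) (g₁ x)
    linarith
  have hsmooth := integral_mul_translate_sub_le_of_contDiff hρ hg hgc (by positivity) hgM a
  have hgν : ∀ m : Measure ℝ, [IsFiniteMeasure m] → Integrable g m := fun m _ =>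
    Integrable.of_bound hg.continuous.aestronglyMeasurable _ (Filter.Eventually.of_forall hgM)
  have hψν : ∀ m : Measure ℝ, [IsFiniteMeasure m] → Integrable ψ m := fun m _ =>
    Integrable.of_bound hψ.aestronglyMeasurable _ (Filter.Eventually.of_forall hψM)
  have hdens : ∀ f : ℝ → ℝ, ∫ x, f x ∂ν = ∫ x, ρ x * f x := by
    intro f
    rw [hν, integral_withDensity_eq_integral_toReal_smul₀ hρ_int.aemeasurable.ennreal_ofReal
      (by simp)]
    simp [ENNReal.toReal_ofReal, hρ_nonneg]
  have hgdiff : ∫ x, g (x + a) ∂ν - ∫ x, g x ∂ν ≤ (M + δ) * |a| * varNorm ρ := by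
    rw [← integral_sub, hdens]
    · exact hsmooth
    · exact Integrable.of_bound (by fun_prop) _
        (Filter.Eventually.of_forall fun x => hgM (x + a))
    · exact hgν ν
  have happrox : ∫ x, |ψ x - g x| ∂μ ≤ 3 * δ := by
    calc ∫ x, |ψ x - g x| ∂μ ≤ ∫ x, (‖ψ x - g₀ x‖ + δ) ∂μ := by
          refine integral_mono ((hψν μ).sub (hgν μ)).abs
            ((hψν μ |>.sub hg₀int).norm.add (integrable_const _)) fun x => ?_
          have h1 := hgδ x
          rw [dist_comm, Real.dist_eq] at h1
          have h2 := hg₁le x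
          have h3 := abs_sub_le (ψ x) (g₁ x) (g x)
          simp only [Real.norm_eq_abs]
          linarith
      _ = ∫ x, ‖ψ x - g₀ x‖ ∂μ + 2 * δ := by
          have h := integral_add (hψν μ |>.sub hg₀int).norm (integrable_const δ)
          simp only [Pi.sub_apply] at h
          rw [h]
          simp [μ, Measure.real, one_add_one_eq_two]
      _ ≤ 3 * δ := by linarith
  have hsplit : ∫ x, |ψ x - g x| ∂μ = ∫ x, |ψ x - g x| ∂ν + ∫ x, |ψ (x + a) - g (x + a)| ∂ν := by
    have h := integral_add_measure ((hψν ν).sub (hgν ν)).abs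
      ((hψν (ν.map fun x => x + a)).sub (hgν (ν.map fun x => x + a))).abs
    simp only [Pi.sub_apply] at h
    rw [h, integral_map hT.aemeasurable]
    exact (hψ.sub hg.continuous.measurable).abs.aestronglyMeasurable
  have hψa : Integrable (fun x => ψ (x + a)) ν :=
    Integrable.of_bound (hψ.comp hT).aestronglyMeasurable M
      (Filter.Eventually.of_forall fun x => hψM (x + a))
  have hga : Integrable (fun x => g (x + a)) ν :=
    Integrable.of_bound (by fun_prop) _ (Filter.Eventually.of_forall fun x => hgM (x + a))
  have e1 : ∫ x, ψ (x + a) ∂ν - ∫ x, g (x + a) ∂ν ≤ ∫ x, |ψ (x + a) - g (x + a)| ∂ν := by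
    rw [← integral_sub hψa hga]
    exact integral_mono (hψa.sub hga) (hψa.sub hga).abs fun x => le_abs_self _
  have e2 : ∫ x, g x ∂ν - ∫ x, ψ x ∂ν ≤ ∫ x, |ψ x - g x| ∂ν := by
    rw [← integral_sub (hgν ν) (hψν ν)]
    refine integral_mono ((hgν ν).sub (hψν ν)) ((hψν ν).sub (hgν ν)).abs fun x => ?_
    rw [abs_sub_comm]
    exact le_abs_self _
  nlinarith

lemma IsProductOf.map_update_eq {d : ℕ} {P : Measure ((Fin d → ℤ) → ℝ)} {ν : Measure ℝ}
    [IsProbabilityMeasure ν] [IsProbabilityMeasure P] (hP : IsProductOf P ν) (k : Fin d → ℤ) :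
    (ν.prod P).map (fun p => Function.update p.2 k p.1) = P := by
  have hmeas : Measurable fun p : ℝ × ((Fin d → ℤ) → ℝ) => Function.update p.2 k p.1 := by
    refine measurable_pi_lambda _ fun i => ?_
    by_cases hi : i = k
    · subst hi
      simpa using measurable_fst
    · simp only [Function.update_of_ne hi]
      fun_prop
  have hPi : P = Measure.infinitePi fun _ => ν :=
    Measure.eq_infinitePi _ fun s B hB => hP s B fun k _ => hB k
  conv_rhs => rw [hPi]
  refine Measure.eq_infinitePi _ fun s B hB => ?_
  rw [Measure.map_apply hmeas (MeasurableSet.pi s.countable_toSet fun i _ => hB i)]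
  by_cases hk : k ∈ s
  · have : (fun p : ℝ × ((Fin d → ℤ) → ℝ) => Function.update p.2 k p.1) ⁻¹' (s : Set _).pi B =
        B k ×ˢ {ω | ∀ i ∈ s.erase k, ω i ∈ B i} := by
      ext p
      simp only [Set.mem_preimage, Set.mem_pi, Finset.mem_coe, Set.mem_prod, Set.mem_ofPred_eq,
        Finset.mem_erase]
      constructor
      · intro h
        refine ⟨by simpa using h k hk, fun i hi => ?_⟩
        simpa [hi.1] using h i hi.2
      · rintro ⟨h1, h2⟩ i hi
        by_cases hik : i = k
        · subst hik
          simpa using h1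
        · simpa [hik] using h2 i ⟨hik, hi⟩
    rw [this, Measure.prod_prod, hP _ _ fun i _ => hB i,
      Finset.mul_prod_erase s (fun i => ν (B i)) hk]
  · have : (fun p : ℝ × ((Fin d → ℤ) → ℝ) => Function.update p.2 k p.1) ⁻¹' (s : Set _).pi B =
        Set.univ ×ˢ {ω | ∀ i ∈ s, ω i ∈ B i} := by
      ext p
      simp only [Set.mem_preimage, Set.mem_pi, Finset.mem_coe, Set.mem_prod, Set.mem_ofPred_eq,
        Set.mem_univ, true_and]
      refine forall₂_congr fun i hi => ?_
      rw [Function.update_of_ne (ne_of_mem_of_not_mem hi hk)]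
    rw [this, Measure.prod_prod, hP _ _ fun i _ => hB i, measure_univ, one_mul]

section Averaging

variable {d : ℕ} {ρ : ℝ → ℝ} {ν : Measure ℝ} {P : Measure ((Fin d → ℤ) → ℝ)}

/-- Effect on expectations of shifting a single coordinate. -/
lemma integral_add_single_sub_le (hρ_nonneg : ∀ x, 0 ≤ ρ x) (hρ_int : Integrable ρ)
    (hρ : BddAbove (varSet ρ))
    (hν : ν = volume.withDensity fun x => ENNReal.ofReal (ρ x)) [IsProbabilityMeasure ν]
    [IsProbabilityMeasure P] (hP : IsProductOf P ν)
    {h : ((Fin d → ℤ) → ℝ) → ℝ} (hh : Measurable h) {K : ℝ} (hK : 0 < K)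
    (h0 : ∀ ω, 0 ≤ h ω) (hhK : ∀ ω, h ω ≤ K) (k : Fin d → ℤ) (a : ℝ) :
    ∫ ω, h (ω + Pi.single k a) ∂P - ∫ ω, h ω ∂P ≤ K / 2 * |a| * varNorm ρ := by
  have hupd : Measurable fun p : ℝ × ((Fin d → ℤ) → ℝ) => Function.update p.2 k p.1 := by
    refine measurable_pi_lambda _ fun i => ?_
    by_cases hi : i = k
    · subst hi
      simpa using measurable_fst
    · simp only [Function.update_of_ne hi]
      fun_prop
  have hbd : ∀ {α : Type} [MeasurableSpace α] (m : Measure α) [IsFiniteMeasure m]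
      {f : α → ((Fin d → ℤ) → ℝ)}, Measurable f → Integrable (fun x => h (f x)) m := by
    intro α _ m _ f hf
    refine Integrable.of_bound (hh.comp hf).aestronglyMeasurable K
      (Filter.Eventually.of_forall fun x => ?_)
    rw [Real.norm_of_nonneg (h0 _)]
    exact hhK _
  have hshift : Measurable fun p : ℝ × ((Fin d → ℤ) → ℝ) =>
      Function.update p.2 k (p.1 + a) :=
    hupd.comp (g := fun p : ℝ × ((Fin d → ℤ) → ℝ) => Function.update p.2 k p.1)
      (f := fun p : ℝ × ((Fin d → ℤ) → ℝ) => (p.1 + a, p.2)) (by fun_prop)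
  have hadd : ∀ (ω : (Fin d → ℤ) → ℝ) (x : ℝ),
      Function.update ω k x + Pi.single k a = Function.update ω k (x + a) := by
    intro ω x
    ext i
    by_cases hi : i = k
    · subst hi; simp
    · simp [hi]
  have e1 : ∫ ω, h (ω + Pi.single k a) ∂P =
      ∫ ω, ∫ x, h (Function.update ω k (x + a)) ∂ν ∂P := by
    conv_lhs => rw [← hP.map_update_eq k]
    rw [integral_map hupd.aemeasurable (by
      exact (hh.comp (measurable_id.add_const _)).aestronglyMeasurable)]
    simp only [hadd]
    rw [integral_prod_symm _ (hbd _ hshift)]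
  have e2 : ∫ ω, h ω ∂P = ∫ ω, ∫ x, h (Function.update ω k x) ∂ν ∂P := by
    conv_lhs => rw [← hP.map_update_eq k]
    rw [integral_map hupd.aemeasurable hh.aestronglyMeasurable,
      integral_prod_symm _ (hbd _ hupd)]
  rw [e1, e2, ← integral_sub (hbd (ν.prod P) hshift).integral_prod_right
    (hbd (ν.prod P) hupd).integral_prod_right]
  calc ∫ ω, (∫ x, h (Function.update ω k (x + a)) ∂ν - ∫ x, h (Function.update ω k x) ∂ν) ∂P
      ≤ ∫ _, K / 2 * |a| * varNorm ρ ∂P := by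
        refine integral_mono ((hbd (ν.prod P) hshift).integral_prod_right.sub
          (hbd (ν.prod P) hupd).integral_prod_right) (integrable_const _) fun ω => ?_
        have hline : Measurable fun x => Function.update ω k x := measurable_update ω
        have := integral_translate_sub_le hρ_nonneg hρ_int hρ hν
          (ψ := fun x => h (Function.update ω k x) - K / 2)
          ((hh.comp hline).sub_const _) (half_pos hK)
          (fun x => abs_le.mpr ⟨by linarith [h0 (Function.update ω k x)],
            by linarith [hhK (Function.update ω k x)]⟩) a
        have hlinea : Measurable fun x => Function.update ω k (x + a) :=
          hline.comp (measurable_id.add_const a)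
        rw [integral_sub (hbd ν hlinea) (integrable_const _),
          integral_sub (hbd ν hline) (integrable_const _)] at this
        simpa using this
    _ = K / 2 * |a| * varNorm ρ := by simp

/-- Effect on expectations of shifting finitely many coordinates. -/
lemma integral_add_sum_single_sub_le (hρ_nonneg : ∀ x, 0 ≤ ρ x) (hρ_int : Integrable ρ)
    (hρ : BddAbove (varSet ρ))
    (hν : ν = volume.withDensity fun x => ENNReal.ofReal (ρ x)) [IsProbabilityMeasure ν]
    [IsProbabilityMeasure P] (hP : IsProductOf P ν)
    {h : ((Fin d → ℤ) → ℝ) → ℝ} (hh : Measurable h) {K : ℝ} (hK : 0 < K)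
    (h0 : ∀ ω, 0 ≤ h ω) (hhK : ∀ ω, h ω ≤ K) (a : (Fin d → ℤ) → ℝ) (S : Finset (Fin d → ℤ)) :
    ∫ ω, h (ω + ∑ k ∈ S, Pi.single k (a k)) ∂P - ∫ ω, h ω ∂P ≤
      K / 2 * (∑ k ∈ S, |a k|) * varNorm ρ := by
  induction S using Finset.induction_on with
  | empty => simp
  | insert k S hk ih =>
    have := integral_add_single_sub_le hρ_nonneg hρ_int hρ hν hP
      (h := fun ω => h (ω + ∑ k ∈ S, Pi.single k (a k)))
      (hh.comp (measurable_id.add_const _)) hK (fun ω => h0 _) (fun ω => hhK _) k (a k)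
    rw [Finset.sum_insert hk, Finset.sum_insert hk]
    simp only [add_assoc] at this
    linarith

/-- A nonnegative observable whose integrals along the lines in direction `t` are bounded by `K`
has small expectation. -/
lemma integral_le_of_line_lintegral_le (hρ_nonneg : ∀ x, 0 ≤ ρ x) (hρ_int : Integrable ρ)
    (hρ : BddAbove (varSet ρ))
    (hν : ν = volume.withDensity fun x => ENNReal.ofReal (ρ x)) [IsProbabilityMeasure ν]
    [IsProbabilityMeasure P] (hP : IsProductOf P ν)
    {g : ((Fin d → ℤ) → ℝ) → ℝ} (hg : Measurable g) (hg0 : ∀ ω, 0 ≤ g ω) {B : ℝ}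
    (hgB : ∀ ω, g ω ≤ B) {t : (Fin d → ℤ) → ℝ} (ht : (Function.support t).Finite)
    (hcont : ∀ ω, Continuous fun r : ℝ => g (ω + r • t)) {K : ℝ} (hK : 0 < K)
    (hline : ∀ ω, ∫⁻ r : ℝ, ENNReal.ofReal (g (ω + r • t)) ≤ ENNReal.ofReal K) :
    ∫ ω, g ω ∂P ≤ K / 2 * (∑' k, |t k|) * varNorm ρ := by
  have hjoint : Measurable fun p : ((Fin d → ℤ) → ℝ) × ℝ => g (p.1 + p.2 • t) :=
    hg.comp (by fun_prop)
  have hint : ∀ ω, Integrable fun r : ℝ => g (ω + r • t) := fun ω =>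
    ⟨(hcont ω).aestronglyMeasurable, by
      rw [hasFiniteIntegral_iff_ofReal (Filter.Eventually.of_forall fun r => hg0 _)]
      exact (hline ω).trans_lt ENNReal.ofReal_lt_top⟩
  have hintK : ∀ ω, ∫ r, g (ω + r • t) ≤ K := fun ω => by
    rw [integral_eq_lintegral_of_nonneg_ae (Filter.Eventually.of_forall fun r => hg0 _)
      (hcont ω).aestronglyMeasurable]
    exact ENNReal.toReal_le_of_le_ofReal hK.le (hline ω)
  let h : ((Fin d → ℤ) → ℝ) → ℝ := fun ω => ∫ r in Set.Iic (0 : ℝ), g (ω + r • t)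
  have hh : Measurable h :=
    (hjoint.stronglyMeasurable.integral_prod_right
      (ν := volume.restrict (Set.Iic (0 : ℝ)))).measurable
  have h0 : ∀ ω, 0 ≤ h ω := fun ω => integral_nonneg fun r => hg0 _
  have hhK : ∀ ω, h ω ≤ K := fun ω =>
    (setIntegral_le_integral (hint ω) (Filter.Eventually.of_forall fun r => hg0 _)).trans (hintK ω)
  have hhint : ∀ a, Integrable (fun ω => h (ω + a)) P := fun a =>
    Integrable.of_bound (hh.comp (measurable_id.add_const a)).aestronglyMeasurable K
      (Filter.Eventually.of_forall fun ω => by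
        rw [Real.norm_of_nonneg (h0 _)]; exact hhK _)
  have hshift : ∀ ω (s : ℝ), h (ω + s • t) - h ω = ∫ r in (0 : ℝ)..s, g (ω + r • t) := by
    intro ω s
    rw [← intervalIntegral.integral_Iic_sub_Iic (hint ω).integrableOn (hint ω).integrableOn]
    congr 1
    have hmp : MeasurePreserving (fun r : ℝ => r + s) volume volume :=
      measurePreserving_add_right volume s
    have := hmp.setIntegral_preimage_emb (MeasurableEquiv.addRight s).measurableEmbedding
      (fun r => g (ω + r • t)) (Set.Iic s)
    rw [← this]
    simp only [h, Set.preimage_add_const_Iic, sub_self]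
    congr 1
    ext r
    rw [add_smul, add_comm (r • t), add_assoc]
  let φ : ℝ → ℝ := fun r => ∫ ω, g (ω + r • t) ∂P
  have hφ : Continuous φ := by
    refine continuous_of_dominated (bound := fun _ => B) (fun r => ?_) (fun r => ?_)
      (integrable_const _) (Filter.Eventually.of_forall hcont)
    · exact (hg.comp (measurable_id.add_const _)).aestronglyMeasurable
    · refine Filter.Eventually.of_forall fun ω => ?_
      rw [Real.norm_of_nonneg (hg0 _)]
      exact hgB _
  have hφint : ∀ s, 0 < s → ∫ r in (0 : ℝ)..s, φ r ≤
      s * (K / 2 * (∑' k, |t k|) * varNorm ρ) := by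
    intro s hs
    have hswap : ∫ r in (0 : ℝ)..s, φ r = ∫ ω, h (ω + s • t) ∂P - ∫ ω, h ω ∂P := by
      have h00 := hhint 0
      simp only [add_zero] at h00
      rw [← integral_sub (hhint _) h00]
      simp only [hshift, φ]
      simp only [intervalIntegral.integral_of_le hs.le]
      refine integral_integral_swap ?_
      refine Integrable.of_bound (hjoint.comp measurable_swap).aestronglyMeasurable B
        (Filter.Eventually.of_forall fun p => ?_)
      simp only [Function.uncurry]
      rw [Real.norm_of_nonneg (hg0 _)]
      exact hgB _
    have hsum : s • t = ∑ k ∈ ht.toFinset, Pi.single k (s * t k) := by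
      ext i
      rw [Finset.sum_apply]
      simp only [Pi.single_apply, Finset.sum_ite_eq, Pi.smul_apply, smul_eq_mul]
      split_ifs with hi
      · rfl
      · have : t i = 0 := by simpa using hi
        simp [this]
    rw [hswap, hsum]
    refine (integral_add_sum_single_sub_le hρ_nonneg hρ_int hρ hν hP hh hK h0 hhK
      (fun k => s * t k) ht.toFinset).trans (le_of_eq ?_)
    rw [tsum_eq_sum (s := ht.toFinset) (fun k hk => by simpa using hk)]
    simp only [abs_mul, abs_of_pos hs, ← Finset.mul_sum]
    ring
  have hφ0 : φ 0 = ∫ ω, g ω ∂P := by simp [φ]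
  rw [← hφ0]
  have hder : HasDerivAt (fun s => ∫ r in (0 : ℝ)..s, φ r) (φ 0) 0 :=
    (hφ.integral_hasStrictDerivAt 0 0).hasDerivAt
  have htend := (hasDerivAt_iff_tendsto_slope_zero.mp hder).mono_left
    (nhdsWithin_mono (0 : ℝ) (fun s (hs : 0 < s) => hs.ne') :
      nhdsWithin (0 : ℝ) (Set.Ioi 0) ≤ nhdsWithin 0 {0}ᶜ)
  refine le_of_tendsto htend ?_
  filter_upwards [self_mem_nhdsWithin] with s hs
  have hs' : 0 < s := hs
  simp only [zero_add, intervalIntegral.integral_same, sub_zero, smul_eq_mul]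
  rw [inv_mul_le_iff₀ hs']
  exact hφint s hs'

end Averaging

section Resolvent

variable {m : Type*} [Fintype m] [DecidableEq m]

/-- The complexification of a real matrix plus a complex diagonal. -/
def pencil (H : Matrix m m ℝ) (v : m → ℂ) : Matrix m m ℂ :=
  H.map Complex.ofReal + Matrix.diagonal v

/-- The diagonal entries of the inverse of `pencil H v`. -/
def greenDiag (H : Matrix m m ℝ) (v : m → ℂ) (j : m) : ℂ := (pencil H v)⁻¹ j j

lemma im_star_dotProduct_pencil_mulVec {H : Matrix m m ℝ} (hH : H.IsHermitian) (v x : m → ℂ) :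
    (star x ⬝ᵥ (pencil H v).mulVec x).im = ∑ i, (v i).im * ‖x i‖ ^ 2 := by
  have hH' : (H.map Complex.ofReal).IsHermitian :=
    hH.map _ fun a => by simp
  have h1 := hH'.im_star_dotProduct_mulVec_self x
  simp only [RCLike.im_to_complex] at h1
  rw [pencil, Matrix.add_mulVec, dotProduct_add, Complex.add_im, h1, zero_add]
  simp only [dotProduct, Complex.im_sum, Matrix.mulVec_diagonal, Pi.star_apply]
  refine Finset.sum_congr rfl fun i _ => ?_
  have : star (x i) * (v i * x i) = v i * ((‖x i‖ ^ 2 : ℝ) : ℂ) := by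
    rw [mul_left_comm]
    congr 1
    simp [← Complex.conj_mul']
  rw [this, Complex.im_mul_ofReal]

lemma isUnit_det_pencil {H : Matrix m m ℝ} (hH : H.IsHermitian) {v : m → ℂ}
    (hv : ∀ i, (v i).im < 0) : IsUnit (pencil H v).det := by
  rw [isUnit_iff_ne_zero]
  intro hdet
  obtain ⟨x, hx, hMx⟩ := Matrix.exists_mulVec_eq_zero_iff.mpr hdet
  have h := im_star_dotProduct_pencil_mulVec hH v x
  rw [hMx, dotProduct_zero, Complex.zero_im] at h
  obtain ⟨i, hi⟩ := Function.ne_iff.mp hx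
  have : ∑ i, (v i).im * ‖x i‖ ^ 2 < 0 := by
    refine Finset.sum_neg' (fun k _ => mul_nonpos_of_nonpos_of_nonneg (hv k).le (by positivity))
      ⟨i, Finset.mem_univ _, mul_neg_of_neg_of_pos (hv i) ?_⟩
    have : 0 < ‖x i‖ := norm_pos_iff.mpr hi
    positivity
  linarith

lemma pencil_mulVec_inv_col {H : Matrix m m ℝ} (hH : H.IsHermitian) {v : m → ℂ}
    (hv : ∀ i, (v i).im < 0) (j : m) :
    (pencil H v).mulVec (fun i => (pencil H v)⁻¹ i j) = Pi.single j 1 := by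
  have h := Matrix.mul_nonsing_inv (pencil H v) (isUnit_det_pencil hH hv)
  ext i
  have := congrFun (congrFun h i) j
  rw [Matrix.mul_apply] at this
  simp only [Matrix.mulVec, dotProduct, this, Matrix.one_apply, Pi.single_apply]

lemma im_greenDiag {H : Matrix m m ℝ} (hH : H.IsHermitian) {v : m → ℂ}
    (hv : ∀ i, (v i).im < 0) (j : m) :
    (greenDiag H v j).im = ∑ i, -(v i).im * ‖(pencil H v)⁻¹ i j‖ ^ 2 := by
  have h := im_star_dotProduct_pencil_mulVec hH v fun i => (pencil H v)⁻¹ i j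
  rw [pencil_mulVec_inv_col hH hv, dotProduct_single, mul_one] at h
  simp only [Pi.star_apply, Complex.star_def, Complex.conj_im] at h
  simp only [neg_mul, Finset.sum_neg_distrib, ← h, neg_neg, greenDiag]

lemma im_greenDiag_nonneg {H : Matrix m m ℝ} (hH : H.IsHermitian) {v : m → ℂ}
    (hv : ∀ i, (v i).im < 0) (j : m) : 0 ≤ (greenDiag H v j).im := by
  rw [im_greenDiag hH hv]
  exact Finset.sum_nonneg fun i _ => mul_nonneg (by linarith [hv i]) (by positivity)

lemma norm_inv_col_sq_le {H : Matrix m m ℝ} (hH : H.IsHermitian) {v : m → ℂ} {ε : ℝ} (hε : 0 < ε)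
    (hv : ∀ i, (v i).im ≤ -ε) (i j : m) :
    ε * ‖(pencil H v)⁻¹ i j‖ ^ 2 ≤ ‖greenDiag H v j‖ := by
  have hv' : ∀ i, (v i).im < 0 := fun i => (hv i).trans_lt (by linarith)
  refine le_trans ?_ ((le_abs_self _).trans (Complex.abs_im_le_norm _))
  rw [im_greenDiag hH hv']
  refine le_trans ?_ (Finset.single_le_sum (f := fun i => -(v i).im * ‖(pencil H v)⁻¹ i j‖ ^ 2)
    (fun k _ => mul_nonneg (by linarith [hv' k]) (by positivity)) (Finset.mem_univ i))
  exact mul_le_mul_of_nonneg_right (by linarith [hv i]) (by positivity)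

lemma norm_greenDiag_le {H : Matrix m m ℝ} (hH : H.IsHermitian) {v : m → ℂ} {ε : ℝ} (hε : 0 < ε)
    (hv : ∀ i, (v i).im ≤ -ε) (j : m) : ‖greenDiag H v j‖ ≤ ε⁻¹ := by
  have h := norm_inv_col_sq_le hH hε hv j j
  change ε * ‖greenDiag H v j‖ ^ 2 ≤ _ at h
  rcases (norm_nonneg (greenDiag H v j)).eq_or_lt with h0 | h0
  · rw [← h0]; positivity
  · rw [le_inv_comm₀ h0 hε, ← one_div, le_div_iff₀ h0]
    nlinarith

lemma differentiableAt_det {M : ℂ → Matrix m m ℂ} {s : ℂ}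
    (hM : ∀ i k, DifferentiableAt ℂ (fun s => M s i k) s) :
    DifferentiableAt ℂ (fun s => (M s).det) s := by
  simp only [Matrix.det_apply]
  refine DifferentiableAt.fun_sum fun σ _ => DifferentiableAt.const_smul ?_ _
  exact DifferentiableAt.fun_finsetProd fun i _ => hM _ _

lemma greenDiag_eq (H : Matrix m m ℝ) (v : m → ℂ) (j : m) :
    greenDiag H v j = (pencil H v).det⁻¹ * (pencil H v).adjugate j j := by
  rw [greenDiag, Matrix.inv_def, Ring.inverse_eq_inv', Matrix.smul_apply, smul_eq_mul]

lemma differentiableAt_greenDiag {H : Matrix m m ℝ} (hH : H.IsHermitian) (a w : m → ℂ) {s : ℂ}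
    (hv : ∀ i, (a i + s * w i).im < 0) (j : m) :
    DifferentiableAt ℂ (fun s => greenDiag H (fun i => a i + s * w i) j) s := by
  simp only [greenDiag_eq]
  have hent : ∀ i k, DifferentiableAt ℂ (fun s => pencil H (fun i => a i + s * w i) i k) s := by
    intro i k
    simp only [pencil, Matrix.add_apply, Matrix.diagonal_apply]
    split_ifs <;> fun_prop
  refine ((differentiableAt_det hent).inv (isUnit_det_pencil hH hv).ne_zero).mul ?_
  simp only [Matrix.adjugate_apply]
  refine differentiableAt_det fun i k => ?_
  simp only [Matrix.updateRow_apply]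
  split_ifs
  · fun_prop
  · exact hent i k

lemma continuous_greenDiag {X : Type*} [TopologicalSpace X] {H : Matrix m m ℝ}
    (hH : H.IsHermitian) {v : X → m → ℂ} (hv : Continuous v) (hneg : ∀ x i, (v x i).im < 0)
    (j : m) : Continuous fun x => greenDiag H (v x) j := by
  simp only [greenDiag_eq]
  have hM : Continuous fun x => pencil H (v x) := by
    unfold pencil
    exact continuous_const.add hv.matrix_diagonal
  refine (hM.matrix_det.inv₀ fun x => (isUnit_det_pencil hH (hneg x)).ne_zero).mul ?_
  exact (hM.matrix_adjugate).matrix_elem j j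

/-- First-order asymptotics of a diagonal Green function entry for large coupling. -/
lemma exists_norm_greenDiag_sub_le {H : Matrix m m ℝ} (hH : H.IsHermitian) {a : m → ℂ} {ε : ℝ}
    (hε : 0 < ε) (ha : ∀ i, (a i).im ≤ -ε) {w : m → ℝ} (hw : ∀ i, 0 ≤ w i) {j : m}
    (hwj : 0 < w j) :
    ∃ C, ∀ s : ℂ, s.im ≤ 0 → 1 ≤ ‖s‖ →
      ‖greenDiag H (fun i => a i + s * w i) j - ((w j : ℂ) * (s - Complex.I))⁻¹‖ ≤
        C / (‖s‖ * √‖s‖) := by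
  set A : ℝ := ∑ k, |H j k| + ‖a j‖ with hA
  have hA0 : 0 ≤ A := by positivity
  set C₁ : ℝ := (1 + A * ε⁻¹) / w j with hC₁
  have hC₁0 : 0 ≤ C₁ := by positivity
  set C₂ : ℝ := A * √(C₁ / ε) with hC₂
  refine ⟨(C₂ + 1) / w j, fun s hs hs1 => ?_⟩
  have hs0 : 0 < ‖s‖ := by linarith
  have hsne : s ≠ 0 := norm_pos_iff.mp hs0
  have hwne : (w j : ℂ) ≠ 0 := by exact_mod_cast hwj.ne'
  set v : m → ℂ := fun i => a i + s * w i with hv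
  have hvim : ∀ i, (v i).im ≤ -ε := by
    intro i
    simp only [hv, Complex.add_im, Complex.im_mul_ofReal]
    nlinarith [ha i, mul_nonneg (neg_nonneg.mpr hs) (hw i)]
  have hvim' : ∀ i, (v i).im < 0 := fun i => (hvim i).trans_lt (by linarith)
  set x : m → ℂ := fun i => (pencil H v)⁻¹ i j with hx
  have hxj : greenDiag H v j = x j := rfl
  have hsq := fun i => norm_inv_col_sq_le hH hε hvim i j
  have hxj1 := norm_greenDiag_le hH hε hvim j
  rw [hxj] at hxj1 ⊢
  have hx1 : ∀ i, ‖x i‖ ≤ ε⁻¹ := by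
    intro i
    have h := (hsq i).trans hxj1
    refine le_of_sq_le_sq ?_ (by positivity)
    rw [← mul_le_mul_iff_right₀ hε]
    refine h.trans (le_of_eq ?_)
    field_simp
  have hrow : s * w j * x j - 1 = -(∑ k, (H j k : ℂ) * x k + a j * x j) := by
    have h := congrFun (pencil_mulVec_inv_col hH hvim' j) j
    rw [pencil, Matrix.add_mulVec, Pi.add_apply, Matrix.mulVec_diagonal, Pi.single_eq_same] at h
    simp only [Matrix.mulVec, dotProduct, Matrix.map_apply] at h
    change ∑ k, (H j k : ℂ) * x k + (a j + s * w j) * x j = 1 at h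
    linear_combination h
  have hrowle : ∀ b, (∀ i, ‖x i‖ ≤ b) → ‖s * w j * x j - 1‖ ≤ A * b := by
    intro b hb
    rw [hrow, norm_neg, hA, add_mul, Finset.sum_mul]
    refine (norm_add_le _ _).trans (add_le_add ((norm_sum_le _ _).trans ?_) ?_)
    · refine Finset.sum_le_sum fun k _ => ?_
      rw [norm_mul, Complex.norm_real, Real.norm_eq_abs]
      exact mul_le_mul_of_nonneg_left (hb k) (abs_nonneg _)
    · rw [norm_mul]
      exact mul_le_mul_of_nonneg_left (hb j) (norm_nonneg _)
  have hxj2 : ‖x j‖ ≤ C₁ / ‖s‖ := by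
    have h1 := hrowle _ hx1
    have h2 : ‖s * w j * x j‖ ≤ 1 + A * ε⁻¹ := by
      have := norm_le_norm_sub_add (s * w j * x j) 1
      rw [norm_one] at this
      linarith
    rw [norm_mul, norm_mul, Complex.norm_real, Real.norm_of_nonneg hwj.le] at h2
    rw [hC₁, le_div_iff₀ hs0, le_div_iff₀ hwj]
    linarith
  have hx2 : ∀ i, ‖x i‖ ≤ √(C₁ / ε) / √‖s‖ := by
    intro i
    rw [← Real.sqrt_div (by positivity)]
    refine Real.le_sqrt_of_sq_le ?_
    have h := (hsq i).trans hxj2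
    rw [div_div, mul_comm ε, ← div_div, le_div_iff₀ hε]
    linarith
  have hmain := hrowle _ hx2
  have hsI : ‖s‖ ≤ ‖s - Complex.I‖ := by
    refine le_of_sq_le_sq ?_ (norm_nonneg _)
    rw [← Complex.normSq_eq_norm_sq, ← Complex.normSq_eq_norm_sq, Complex.normSq_apply,
      Complex.normSq_apply]
    simp
    nlinarith
  have hsI0 : 0 < ‖s - Complex.I‖ := hs0.trans_le hsI
  have hsIne : s - Complex.I ≠ 0 := norm_pos_iff.mp hsI0
  have hD : s * w j * (x j - ((w j : ℂ) * (s - Complex.I))⁻¹) =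
      (s * w j * x j - 1) + -(Complex.I / (s - Complex.I)) := by
    field_simp
    ring
  have hsqrt : √‖s‖ ≤ ‖s‖ := by
    rw [Real.sqrt_le_left hs0.le]
    nlinarith
  have hsqrt0 : 0 < √‖s‖ := Real.sqrt_pos.mpr hs0
  have hDn : ‖s‖ * w j * ‖x j - ((w j : ℂ) * (s - Complex.I))⁻¹‖ ≤ (C₂ + 1) / √‖s‖ := by
    have h1 := norm_add_le (s * w j * x j - 1) (-(Complex.I / (s - Complex.I)))
    rw [← hD, norm_neg, norm_div, Complex.norm_I, norm_mul, norm_mul, Complex.norm_real,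
      Real.norm_of_nonneg hwj.le] at h1
    refine h1.trans ?_
    rw [add_div]
    refine add_le_add (hmain.trans (le_of_eq ?_)) ?_
    · rw [hC₂, mul_div_assoc]
    · exact one_div_le_one_div_of_le hsqrt0 (hsqrt.trans hsI)
  rw [le_div_iff₀ hsqrt0] at hDn
  rw [div_div, le_div_iff₀ (by positivity)]
  linarith

end Resolvent

section SpectralAveraging

variable {m : Type*} [Fintype m] [DecidableEq m]

lemma exists_integral_im_greenDiag_le {H : Matrix m m ℝ} (hH : H.IsHermitian) {a : m → ℂ} {ε : ℝ}
    (hε : 0 < ε) (ha : ∀ i, (a i).im ≤ -ε) {w : m → ℝ} (hw : ∀ i, 0 ≤ w i) {j : m}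
    (hwj : 0 < w j) :
    ∃ C, ∀ R : ℝ, 1 ≤ R →
      ∫ r in -R..R, (greenDiag H (fun i => a i + (r : ℂ) * w i) j).im ≤
        Real.pi / w j + C / √R := by
  obtain ⟨C, hC⟩ := exists_norm_greenDiag_sub_le hH hε ha hw hwj
  refine ⟨4 * C, fun R hR => ?_⟩
  have hR0 : 0 < R := by linarith
  have hwne : (w j : ℂ) ≠ 0 := by exact_mod_cast hwj.ne'
  have hneg : ∀ s : ℂ, s.im ≤ 0 → ∀ i, (a i + s * w i).im < 0 := by
    intro s hs i
    simp only [Complex.add_im, Complex.im_mul_ofReal]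
    nlinarith [ha i, mul_nonneg (neg_nonneg.mpr hs) (hw i)]
  have hI : ∀ s : ℂ, s.im ≤ 0 → s - Complex.I ≠ 0 := by
    intro s hs h
    have := congrArg Complex.im h
    simp at this
    linarith
  have hC0 : 0 ≤ C := by
    have h := (norm_nonneg _).trans (hC 1 (by simp) (by simp))
    simpa using h
  set G : ℂ → ℂ := fun s => greenDiag H (fun i => a i + s * w i) j with hG
  set L : ℂ → ℂ := fun s => ((w j : ℂ) * (s - Complex.I))⁻¹ with hL
  have hGd : ∀ s : ℂ, s.im ≤ 0 → DifferentiableAt ℂ G s := fun s hs =>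
    differentiableAt_greenDiag hH a (fun i => w i) (hneg s hs) j
  have hLd : ∀ s : ℂ, s.im ≤ 0 → DifferentiableAt ℂ L s := fun s hs =>
    DifferentiableAt.inv (by fun_prop) (mul_ne_zero hwne (hI s hs))
  set b := C / (R * √R) with hb
  have hbound : ∀ s : ℂ, s.im ≤ 0 → R ≤ ‖s‖ → ‖G s - L s‖ ≤ b := fun s hs hRs =>
    (hC s hs (hR.trans hRs)).trans (by rw [hb]; gcongr)
  have hrect := Complex.integral_boundary_rect_eq_zero_of_differentiableOn (fun s => G s - L s)
    (-R - R * Complex.I) R (by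
      intro s hs
      refine ((hGd s ?_).sub (hLd s ?_)).differentiableWithinAt <;>
      · have h2 := (Complex.mem_reProdIm.mp hs).2
        simp only [Complex.sub_im, Complex.neg_im, Complex.ofReal_im, Complex.im_ofReal_mul,
          Complex.I_im] at h2
        rw [Set.uIcc_of_le (by linarith)] at h2
        exact h2.2)
  simp only [Complex.sub_re, Complex.sub_im, Complex.neg_re, Complex.neg_im, Complex.ofReal_re,
    Complex.ofReal_im, Complex.re_ofReal_mul, Complex.im_ofReal_mul, Complex.I_re, Complex.I_im,
    mul_zero, mul_one, sub_zero, neg_zero, zero_sub, Complex.ofReal_zero, zero_mul, add_zero,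
    smul_eq_mul] at hrect
  have hbot : ‖∫ x in -R..R, (G (x + (-R : ℝ) * Complex.I) - L (x + (-R : ℝ) * Complex.I))‖ ≤
      b * |R - -R| := by
    refine intervalIntegral.norm_integral_le_of_norm_le_const fun x _ => hbound _ ?_ ?_
    · simp; linarith
    · refine le_trans ?_ (Complex.abs_im_le_norm _)
      simp [abs_of_pos hR0]
  have hside : ∀ c : ℝ, |c| = R →
      ‖∫ y in -R..0, (G ((c : ℝ) + y * Complex.I) - L ((c : ℝ) + y * Complex.I))‖ ≤
      b * |0 - -R| := by
    intro c hc
    refine intervalIntegral.norm_integral_le_of_norm_le_const fun y hy => hbound _ ?_ ?_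
    · rw [Set.uIoc_of_le (by linarith)] at hy
      simpa using hy.2
    · refine le_trans ?_ (Complex.abs_re_le_norm _)
      simp [hc]
  have hr := hside R (abs_of_pos hR0)
  have hl := hside (-R) (by rw [abs_neg, abs_of_pos hR0])
  have hGc : Continuous fun r : ℝ => G r := by
    refine continuous_iff_continuousAt.mpr fun r => ?_
    exact ContinuousAt.comp (f := fun r : ℝ => (r : ℂ)) (hGd r (by simp)).continuousAt
      Complex.continuous_ofReal.continuousAt
  have hLc : Continuous fun r : ℝ => L r := by
    refine continuous_iff_continuousAt.mpr fun r => ?_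
    exact ContinuousAt.comp (f := fun r : ℝ => (r : ℂ)) (hLd r (by simp)).continuousAt
      Complex.continuous_ofReal.continuousAt
  have hLim : ∀ r : ℝ, (L r).im = (w j)⁻¹ * (1 + r ^ 2)⁻¹ := by
    intro r
    have h : L r = (w j : ℂ)⁻¹ * ((r : ℂ) - Complex.I)⁻¹ := by
      simp only [hL, mul_inv]
    rw [h, ← Complex.ofReal_inv, Complex.im_ofReal_mul, Complex.inv_im, Complex.normSq_apply]
    simp
    ring_nf
    simp
  have htop : ‖∫ x in -R..R, (G (x : ℝ) - L (x : ℝ))‖ ≤ 4 * R * b := by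
    have heq : ∫ x in -R..R, (G (x : ℝ) - L (x : ℝ)) =
        (∫ x in -R..R, (G (x + (-R : ℝ) * Complex.I) - L (x + (-R : ℝ) * Complex.I))) +
        Complex.I * (∫ y in -R..0, (G (R + y * Complex.I) - L (R + y * Complex.I))) -
        Complex.I * (∫ y in -R..0, (G ((-R : ℝ) + y * Complex.I) -
          L ((-R : ℝ) + y * Complex.I))) := by
      simp only [Complex.ofReal_neg] at hrect ⊢
      linear_combination -hrect
    rw [heq]
    refine (norm_sub_le _ _).trans ?_
    refine (add_le_add (norm_add_le _ _) le_rfl).trans ?_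
    rw [norm_mul, norm_mul, Complex.norm_I, one_mul, one_mul]
    rw [abs_of_pos (by linarith)] at hbot hr hl
    linarith
  have hsplit : ∫ r in -R..R, (G (r : ℝ)).im =
      (∫ r in -R..R, (L (r : ℝ)).im) + (∫ r in -R..R, (G (r : ℝ) - L (r : ℝ))).im := by
    have h1 : (∫ r in -R..R, (G (r : ℝ) - L (r : ℝ))).im =
        ∫ r in -R..R, (G (r : ℝ) - L (r : ℝ)).im := by
      have := Complex.imCLM.intervalIntegral_comp_comm
        ((hGc.sub hLc).intervalIntegrable (μ := volume) (-R) R)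
      simpa using this.symm
    have h2 : Continuous fun r : ℝ => (L r).im := Complex.continuous_im.comp hLc
    have h3 : Continuous fun r : ℝ => (G r - L r).im := Complex.continuous_im.comp (hGc.sub hLc)
    rw [h1, ← intervalIntegral.integral_add (h2.intervalIntegrable _ _)
      (h3.intervalIntegrable _ _)]
    refine intervalIntegral.integral_congr fun r _ => ?_
    simp
  have hLint : ∫ r in -R..R, (L (r : ℝ)).im ≤ Real.pi / w j := by
    simp only [hLim]
    rw [intervalIntegral.integral_const_mul, integral_inv_one_add_sq, div_eq_inv_mul]
    refine mul_le_mul_of_nonneg_left ?_ (by positivity)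
    linarith [Real.arctan_lt_pi_div_two R, Real.neg_pi_div_two_lt_arctan (-R)]
  have him := (le_abs_self _).trans ((Complex.abs_im_le_norm _).trans htop)
  have hfin : 4 * R * b = 4 * C / √R := by
    rw [hb]
    field_simp
  change ∫ r in -R..R, (G (r : ℝ)).im ≤ _
  rw [hsplit]
  linarith

/-- **Spectral averaging**: integrating the imaginary part of a Green function entry along a line
in the direction of a nonnegative diagonal perturbation. -/
lemma lintegral_im_greenDiag_le {H : Matrix m m ℝ} (hH : H.IsHermitian) {a : m → ℂ} {ε : ℝ}
    (hε : 0 < ε) (ha : ∀ i, (a i).im ≤ -ε) {w : m → ℝ} (hw : ∀ i, 0 ≤ w i) {j : m}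
    (hwj : 0 < w j) :
    ∫⁻ r : ℝ, ENNReal.ofReal (greenDiag H (fun i => a i + (r : ℂ) * w i) j).im ≤
      ENNReal.ofReal (Real.pi / w j) := by
  obtain ⟨C, hC⟩ := exists_integral_im_greenDiag_le hH hε ha hw hwj
  have hneg : ∀ (r : ℝ) i, (a i + (r : ℂ) * w i).im < 0 := by
    intro r i
    rw [← Complex.ofReal_mul, Complex.add_im, Complex.ofReal_im, add_zero]
    linarith [ha i]
  set f : ℝ → ℝ := fun r => (greenDiag H (fun i => a i + (r : ℂ) * w i) j).im with hf
  have hfc : Continuous f := Complex.continuous_im.comp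
    (continuous_greenDiag hH (v := fun (r : ℝ) i => a i + (r : ℂ) * w i) (by fun_prop) hneg j)
  have hf0 : ∀ r, 0 ≤ f r := fun r => im_greenDiag_nonneg hH (hneg r) j
  have hcov : AECover volume Filter.atTop fun R : ℝ => Set.Ioc (-R) R :=
    aecover_Ioc Filter.tendsto_neg_atTop_atBot Filter.tendsto_id
  have hlim := hcov.lintegral_tendsto_of_countably_generated
    (f := fun r => ENNReal.ofReal (f r)) hfc.measurable.ennreal_ofReal.aemeasurable
  have hlim2 : Filter.Tendsto (fun R => ENNReal.ofReal (Real.pi / w j + C / √R)) Filter.atTop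
      (nhds (ENNReal.ofReal (Real.pi / w j + 0))) :=
    ENNReal.tendsto_ofReal
      (tendsto_const_nhds.add (Real.tendsto_sqrt_atTop.const_div_atTop C))
  rw [add_zero] at hlim2
  refine le_of_tendsto_of_tendsto hlim hlim2 ?_
  filter_upwards [Filter.eventually_ge_atTop 1] with R hR
  rw [← ofReal_integral_eq_lintegral_ofReal
    (hfc.integrableOn_Ioc) (Filter.Eventually.of_forall hf0),
    ← intervalIntegral.integral_of_le (by linarith)]
  exact ENNReal.ofReal_le_ofReal (hC R hR)

end SpectralAveraging

section EigenvalueCounting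

variable {m : Type*} [Fintype m] [DecidableEq m]

lemma sum_greenDiag_eq {H : Matrix m m ℝ} (hH : H.IsHermitian) {z : ℂ} (hz : z.im ≠ 0) :
    ∑ j, greenDiag H (fun _ => -z) j = ∑ i, ((hH.eigenvalues i : ℂ) - z)⁻¹ := by
  set U : Matrix m m ℝ := hH.eigenvectorUnitary.1 with hU
  have hUU : U * star U = 1 := Unitary.coe_mul_star_self hH.eigenvectorUnitary
  have hUU' : star U * U = 1 := Unitary.coe_star_mul_self hH.eigenvectorUnitary
  have hspec : H = U * Matrix.diagonal hH.eigenvalues * star U := by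
    have := hH.spectral_theorem
    rw [Unitary.conjStarAlgAut_apply] at this
    simpa using! this
  let φ : Matrix m m ℝ →+* Matrix m m ℂ := Complex.ofRealHom.mapMatrix
  have hne : ∀ i, (hH.eigenvalues i : ℂ) - z ≠ 0 := by
    intro i h
    have := congrArg Complex.im h
    simp at this
    exact hz this
  have hφU : φ U * φ (star U) = 1 := by rw [← map_mul, hUU, map_one]
  have hφU' : φ (star U) * φ U = 1 := by rw [← map_mul, hUU', map_one]
  have hpencil : pencil H (fun _ => -z) =
      φ U * Matrix.diagonal (fun i => (hH.eigenvalues i : ℂ) - z) * φ (star U) := by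
    have h1 : H.map Complex.ofReal =
        φ U * Matrix.diagonal (fun i => (hH.eigenvalues i : ℂ)) * φ (star U) := by
      have h2 : H.map Complex.ofReal = φ H := rfl
      have h3 : φ (Matrix.diagonal hH.eigenvalues) =
          Matrix.diagonal (fun i => (hH.eigenvalues i : ℂ)) := by
        simp [φ, Matrix.diagonal_map]
      rw [h2, ← h3, ← map_mul, ← map_mul, ← hspec]
    have h4 : (Matrix.diagonal fun _ => -z : Matrix m m ℂ) =
        φ U * (Matrix.diagonal fun _ => -z) * φ (star U) := by
      rw [← Matrix.smul_one_eq_diagonal, mul_smul_comm, mul_one, smul_mul_assoc, hφU]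
    rw [pencil, h1, h4, ← add_mul, ← mul_add, Matrix.diagonal_add]
    simp only [sub_eq_add_neg]
  have hinv : (pencil H fun _ => -z)⁻¹ =
      φ U * Matrix.diagonal (fun i => ((hH.eigenvalues i : ℂ) - z)⁻¹) * φ (star U) := by
    refine Matrix.inv_eq_right_inv ?_
    rw [hpencil]
    calc _ = φ U * (Matrix.diagonal (fun i => (hH.eigenvalues i : ℂ) - z) *
          (φ (star U) * φ U) * Matrix.diagonal (fun i => ((hH.eigenvalues i : ℂ) - z)⁻¹)) *
          φ (star U) := by simp only [mul_assoc]
      _ = 1 := by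
        rw [hφU', mul_one, Matrix.diagonal_mul_diagonal]
        simp only [mul_inv_cancel₀ (hne _), Matrix.diagonal_one, mul_one, hφU]
  calc ∑ j, greenDiag H (fun _ => -z) j = ((pencil H fun _ => -z)⁻¹).trace := rfl
    _ = _ := by
      rw [hinv, Matrix.trace_mul_comm, ← mul_assoc, hφU', one_mul, Matrix.trace_diagonal]

lemma integral_poisson_ge {ε η E₁ E₂ x : ℝ} (hε : 0 < ε) (hx : x ∈ Set.Icc E₁ E₂) :
    2 * Real.arctan (η / ε) ≤
      ∫ E in (E₁ - η)..(E₂ + η), (((x : ℂ) - (E + ε * Complex.I))⁻¹).im := by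
  have him : ∀ E : ℝ, (((x : ℂ) - (E + ε * Complex.I))⁻¹).im =
      1 / (1 + ((E - x) / ε) ^ 2) * (1 / ε) := by
    intro E
    rw [Complex.inv_im, Complex.normSq_apply]
    have : 0 < (x - E) * (x - E) + ε * ε := by nlinarith [mul_self_nonneg (x - E)]
    have h2 : 0 < ε ^ 2 + (E - x) ^ 2 := by positivity
    simp
    field_simp
    ring
  have hder : ∀ E ∈ Set.uIcc (E₁ - η) (E₂ + η), HasDerivAt (fun E => Real.arctan ((E - x) / ε))
      (1 / (1 + ((E - x) / ε) ^ 2) * (1 / ε)) E := fun E _ =>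
    (((hasDerivAt_id E).sub_const x).div_const ε).arctan
  simp only [him]
  have hpos : ∀ E : ℝ, 1 + ((E - x) / ε) ^ 2 ≠ 0 := fun E => by positivity
  rw [intervalIntegral.integral_eq_sub_of_hasDerivAt hder
    (Continuous.intervalIntegrable (by fun_prop (disch := exact hpos _)) _ _)]
  have h1 : Real.arctan (η / ε) ≤ Real.arctan ((E₂ + η - x) / ε) := by
    refine Real.arctan_strictMono.monotone ?_
    gcongr
    linarith [hx.2]
  have h2 : Real.arctan ((E₁ - η - x) / ε) ≤ Real.arctan (-(η / ε)) := by
    refine Real.arctan_strictMono.monotone ?_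
    rw [← neg_div]
    gcongr
    linarith [hx.1]
  rw [Real.arctan_neg] at h2
  linarith

/-- Eigenvalue counting is controlled by the trace of the imaginary part of the resolvent. -/
lemma eigCount_mul_arctan_le {H : Matrix m m ℝ} (hH : H.IsHermitian) {ε η E₁ E₂ : ℝ} (hε : 0 < ε)
    (hη : 0 < η) (hE : E₁ ≤ E₂) :
    (eigCount H (Set.Icc E₁ E₂) : ℝ≥0∞) * ENNReal.ofReal (2 * Real.arctan (η / ε)) ≤
      ∫⁻ E in Set.Ioc (E₁ - η) (E₂ + η),
        ∑ j, ENNReal.ofReal (greenDiag H (fun _ => -((E : ℂ) + ε * Complex.I)) j).im := by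
  have hneg : ∀ (E : ℝ) (_ : m), (-((E : ℂ) + ε * Complex.I)).im < 0 := by
    intro E _
    simpa using hε
  have hne : ∀ (x E : ℝ), (x : ℂ) - (E + ε * Complex.I) ≠ 0 := by
    intro x E h
    have := congrArg Complex.im h
    simp at this
    exact hε.ne' this
  have hcont : ∀ x : ℝ, Continuous fun E : ℝ => (((x : ℂ) - (E + ε * Complex.I))⁻¹).im := fun x =>
    Complex.continuous_im.comp (Continuous.inv₀ (by fun_prop) (hne x))
  have hnn : ∀ x E : ℝ, 0 ≤ (((x : ℂ) - (E + ε * Complex.I))⁻¹).im := by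
    intro x E
    rw [Complex.inv_im]
    have : (0 : ℝ) ≤ ε / Complex.normSq ((x : ℂ) - (E + ε * Complex.I)) :=
      div_nonneg hε.le (Complex.normSq_nonneg _)
    simpa using this
  have hsum : ∀ E : ℝ,
      ∑ j, ENNReal.ofReal (greenDiag H (fun _ => -((E : ℂ) + ε * Complex.I)) j).im =
      ∑ i, ENNReal.ofReal (((hH.eigenvalues i : ℂ) - (E + ε * Complex.I))⁻¹).im := by
    intro E
    rw [← ENNReal.ofReal_sum_of_nonneg fun j _ => im_greenDiag_nonneg hH (hneg E) j,
      ← ENNReal.ofReal_sum_of_nonneg fun i _ => hnn _ E, ← Complex.im_sum, ← Complex.im_sum,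
      sum_greenDiag_eq hH (by simpa using hε.ne')]
  simp only [hsum]
  rw [lintegral_finsetSum _ fun i _ => (hcont _).measurable.ennreal_ofReal]
  have hterm : ∀ i, hH.eigenvalues i ∈ Set.Icc E₁ E₂ →
      ENNReal.ofReal (2 * Real.arctan (η / ε)) ≤ ∫⁻ E in Set.Ioc (E₁ - η) (E₂ + η),
        ENNReal.ofReal (((hH.eigenvalues i : ℂ) - (E + ε * Complex.I))⁻¹).im := by
    intro i hi
    rw [← ofReal_integral_eq_lintegral_ofReal (hcont _).integrableOn_Ioc
      (Filter.Eventually.of_forall fun E => hnn _ E),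
      ← intervalIntegral.integral_of_le (by linarith)]
    exact ENNReal.ofReal_le_ofReal (integral_poisson_ge hε hi)
  classical
  rw [eigCount, dif_pos hH, Nat.card_eq_fintype_card, Fintype.card_subtype, ← nsmul_eq_mul]
  refine (Finset.card_nsmul_le_sum _ _ _ fun i hi => hterm i (by simpa using hi)).trans ?_
  exact Finset.sum_le_sum_of_subset (Finset.filter_subset _ _)

end EigenvalueCounting

section AlloyType

variable {d : ℕ}

/-- The kinetic part of the finite-volume Hamiltonian. -/
def hopping (Λ : Finset (Fin d → ℤ)) : Matrix Λ Λ ℝ :=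
  Matrix.of fun x y => if dist1 (x : Fin d → ℤ) (y : Fin d → ℤ) = 1 then -1 else 0

lemma dist1_comm (x y : Fin d → ℤ) : dist1 x y = dist1 y x :=
  Finset.sum_congr rfl fun i _ => by rw [← Int.natAbs_neg, neg_sub]

lemma dist1_self (x : Fin d → ℤ) : dist1 x x = 0 := by simp [dist1]

lemma isHermitian_hopping (Λ : Finset (Fin d → ℤ)) : (hopping Λ).IsHermitian := by
  ext x y
  simp [hopping, dist1_comm]

lemma hamiltonian_eq (lam : ℝ) (u ω : (Fin d → ℤ) → ℝ) (Λ : Finset (Fin d → ℤ)) :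
    hamiltonian lam u ω Λ = hopping Λ + Matrix.diagonal fun x : Λ => lam * potential u ω x := by
  ext x y
  simp only [hamiltonian, hopping, Matrix.of_apply, Matrix.add_apply, Matrix.diagonal_apply]
  by_cases hxy : x = y
  · subst hxy
    simp [dist1_self]
  · simp [hxy]

lemma isHermitian_hamiltonian (lam : ℝ) (u ω : (Fin d → ℤ) → ℝ) (Λ : Finset (Fin d → ℤ)) :
    (hamiltonian lam u ω Λ).IsHermitian := by
  rw [hamiltonian_eq]
  refine (isHermitian_hopping Λ).add (Matrix.isHermitian_diagonal _)

lemma greenDiag_hamiltonian (lam : ℝ) (u ω : (Fin d → ℤ) → ℝ) (Λ : Finset (Fin d → ℤ)) (z : ℂ)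
    (j : Λ) : greenDiag (hamiltonian lam u ω Λ) (fun _ => -z) j =
      greenDiag (hopping Λ) (fun x => ((lam * potential u ω x : ℝ) : ℂ) - z) j := by
  have : pencil (hamiltonian lam u ω Λ) (fun _ => -z) =
      pencil (hopping Λ) (fun x => ((lam * potential u ω x : ℝ) : ℂ) - z) := by
    rw [hamiltonian_eq, pencil, pencil]
    ext x y
    simp only [Matrix.add_apply, Matrix.map_apply, Matrix.diagonal_apply]
    split_ifs <;> push_cast <;> ring
  rw [greenDiag, greenDiag, this]

/-- The configurations for which the potential converges on `Λ`. -/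
def convergenceSet (u : (Fin d → ℤ) → ℝ) (Λ : Finset (Fin d → ℤ)) : Set ((Fin d → ℤ) → ℝ) :=
  {ω | ∀ x : Λ, Summable fun k => ω k * u (x - k)}

lemma measurableSet_convergenceSet (u : (Fin d → ℤ) → ℝ) (Λ : Finset (Fin d → ℤ)) :
    MeasurableSet (convergenceSet u Λ) := by
  have : convergenceSet u Λ = ⋂ x : Λ, {ω | ∑' k, ‖ω k * u (x - k)‖ₑ ≠ ∞} := by
    ext ω
    simp only [convergenceSet, Set.mem_iInter, Set.mem_ofPred_eq,
      tsum_enorm_ne_top_iff_summable_norm, summable_norm_iff]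
  rw [this]
  refine MeasurableSet.iInter fun x => ?_
  have hm : Measurable fun ω : (Fin d → ℤ) → ℝ => ∑' k, ‖ω k * u (x - k)‖ₑ :=
    Measurable.tsum fun k => by fun_prop
  exact hm (measurableSet_singleton ∞).compl

lemma measurable_indicator_potential (u : (Fin d → ℤ) → ℝ) (Λ : Finset (Fin d → ℤ)) (x : Λ) :
    Measurable ((convergenceSet u Λ).indicator fun ω => potential u ω x) := by
  refine measurable_of_tendsto_metrizable' (Filter.atTop (α := Finset (Fin d → ℤ)))
    (f := fun S => (convergenceSet u Λ).indicator fun ω => ∑ k ∈ S, ω k * u (x - k))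
    (fun S => Measurable.indicator (by fun_prop) (measurableSet_convergenceSet u Λ)) ?_
  rw [tendsto_pi_nhds]
  intro ω
  by_cases hω : ω ∈ convergenceSet u Λ
  · simp only [Set.indicator_of_mem hω]
    exact (hω x).hasSum
  · simp only [Set.indicator_of_notMem hω]
    exact tendsto_const_nhds

lemma ae_mem_convergenceSet {P : Measure ((Fin d → ℤ) → ℝ)} {ν : Measure ℝ}
    [IsProbabilityMeasure P] (hP : IsProductOf P ν) {R : ℝ} (hR : ν (Set.Icc (-R) R) = 1)
    {u : (Fin d → ℤ) → ℝ} (hu : Summable fun k => |u k|) (Λ : Finset (Fin d → ℤ)) :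
    ∀ᵐ ω ∂P, ω ∈ convergenceSet u Λ := by
  have hk : ∀ k, ∀ᵐ ω ∂P, ω k ∈ Set.Icc (-R) R := by
    intro k
    have h := hP {k} (fun _ => Set.Icc (-R) R) fun _ _ => measurableSet_Icc
    simp only [Finset.mem_singleton, forall_eq, Finset.prod_singleton, hR] at h
    have hm : MeasurableSet {ω : (Fin d → ℤ) → ℝ | ω k ∈ Set.Icc (-R) R} :=
      (measurable_pi_apply k) measurableSet_Icc
    exact (mem_ae_iff_prob_eq_one hm).mpr h
  filter_upwards [ae_all_iff.mpr hk] with ω hω x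
  have hs : Summable fun k => R * |u (x - k)| :=
    ((Equiv.subLeft (x : Fin d → ℤ)).summable_iff.mpr hu).mul_left R
  refine Summable.of_norm_bounded hs fun k => ?_
  rw [Real.norm_eq_abs, abs_mul]
  exact mul_le_mul_of_nonneg_right (abs_le.mpr (hω k)) (abs_nonneg _)

lemma summable_mul_of_finite_support {t : (Fin d → ℤ) → ℝ} (ht : (Function.support t).Finite)
    (u : (Fin d → ℤ) → ℝ) (x : Fin d → ℤ) : Summable fun k => t k * u (x - k) :=
  summable_of_hasFiniteSupport (ht.subset fun _ hk => left_ne_zero_of_mul hk)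

lemma add_smul_mem_convergenceSet_iff {u : (Fin d → ℤ) → ℝ} {Λ : Finset (Fin d → ℤ)}
    {t : (Fin d → ℤ) → ℝ} (ht : (Function.support t).Finite) (ω : (Fin d → ℤ) → ℝ) (r : ℝ) :
    ω + r • t ∈ convergenceSet u Λ ↔ ω ∈ convergenceSet u Λ := by
  refine forall_congr' fun x => ?_
  have hs := (summable_mul_of_finite_support ht u x).mul_left r
  refine ⟨fun h => (h.sub hs).congr fun k => ?_, fun h => (h.add hs).congr fun k => ?_⟩ <;>
  · simp only [Pi.add_apply, Pi.smul_apply, smul_eq_mul]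
    ring

lemma potential_add_smul {u : (Fin d → ℤ) → ℝ} {Λ : Finset (Fin d → ℤ)}
    {t : (Fin d → ℤ) → ℝ} (ht : (Function.support t).Finite) {ω : (Fin d → ℤ) → ℝ}
    (hω : ω ∈ convergenceSet u Λ) (r : ℝ) (x : Λ) :
    potential u (ω + r • t) x = potential u ω x + r * ∑' k, t k * u (x - k) := by
  simp only [potential, Pi.add_apply, Pi.smul_apply, smul_eq_mul, add_mul, mul_assoc]
  rw [(hω x).tsum_add ((summable_mul_of_finite_support ht u x).mul_left r), tsum_mul_left]

/-- The imaginary part of the diagonal Green function, set to zero where the potential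
diverges. -/
def imGreen (lam : ℝ) (u : (Fin d → ℤ) → ℝ) (Λ : Finset (Fin d → ℤ)) (j : Λ) (ε E : ℝ) :
    ((Fin d → ℤ) → ℝ) → ℝ :=
  (convergenceSet u Λ).indicator fun ω =>
    (greenDiag (hopping Λ) (fun x => ((lam * potential u ω x : ℝ) : ℂ) -
      ((E : ℂ) + ε * Complex.I)) j).im

lemma im_ofReal_sub_neg {ε : ℝ} (hε : 0 < ε) (v E : ℝ) :
    ((v : ℂ) - ((E : ℂ) + ε * Complex.I)).im ≤ -ε ∧
      ((v : ℂ) - ((E : ℂ) + ε * Complex.I)).im < 0 := by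
  simp [hε]

lemma measurable_imGreen (lam : ℝ) (u : (Fin d → ℤ) → ℝ) (Λ : Finset (Fin d → ℤ)) (j : Λ)
    {ε : ℝ} (hε : 0 < ε) :
    Measurable fun p : ((Fin d → ℤ) → ℝ) × ℝ => imGreen lam u Λ j ε p.2 p.1 := by
  have hF : Continuous fun q : (Λ → ℝ) × ℝ => (greenDiag (hopping Λ)
      (fun x => ((lam * q.1 x : ℝ) : ℂ) - ((q.2 : ℂ) + ε * Complex.I)) j).im :=
    Complex.continuous_im.comp (continuous_greenDiag (isHermitian_hopping Λ)
      (v := fun (q : (Λ → ℝ) × ℝ) x => ((lam * q.1 x : ℝ) : ℂ) - ((q.2 : ℂ) + ε * Complex.I))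
      (by fun_prop) (fun q x => (im_ofReal_sub_neg hε _ _).2) j)
  have hV : Measurable fun p : ((Fin d → ℤ) → ℝ) × ℝ => ((fun x : Λ =>
      (convergenceSet u Λ).indicator (fun ω => potential u ω x) p.1 : Λ → ℝ), p.2) :=
    (measurable_pi_lambda _ fun x =>
      (measurable_indicator_potential u Λ x).comp measurable_fst).prodMk measurable_snd
  have hset : MeasurableSet {p : ((Fin d → ℤ) → ℝ) × ℝ | p.1 ∈ convergenceSet u Λ} :=
    measurable_fst (measurableSet_convergenceSet u Λ)
  convert (hF.measurable.comp hV).indicator hset using 1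
  ext p
  by_cases hp : p.1 ∈ convergenceSet u Λ
  · have hp' : p ∈ {p : ((Fin d → ℤ) → ℝ) × ℝ | p.1 ∈ convergenceSet u Λ} := hp
    simp only [imGreen, Set.indicator_of_mem hp, Set.indicator_of_mem hp', Function.comp]
  · have hp' : p ∉ {p : ((Fin d → ℤ) → ℝ) × ℝ | p.1 ∈ convergenceSet u Λ} := hp
    simp only [imGreen, Set.indicator_of_notMem hp, Set.indicator_of_notMem hp']

lemma measurable_imGreen_energy (lam : ℝ) (u : (Fin d → ℤ) → ℝ) (Λ : Finset (Fin d → ℤ))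
    (j : Λ) {ε : ℝ} (hε : 0 < ε) (E : ℝ) : Measurable fun ω => imGreen lam u Λ j ε E ω := by
  have hpair : Measurable fun ω : (Fin d → ℤ) → ℝ => (ω, E) := by fun_prop
  simpa only [Function.comp_def] using (measurable_imGreen lam u Λ j hε).comp hpair

lemma integral_imGreen_le {ρ : ℝ → ℝ} {ν : Measure ℝ} {P : Measure ((Fin d → ℤ) → ℝ)}
    (hρ_nonneg : ∀ x, 0 ≤ ρ x) (hρ_int : Integrable ρ) (hρ : BddAbove (varSet ρ))
    (hν : ν = volume.withDensity fun x => ENNReal.ofReal (ρ x)) [IsProbabilityMeasure ν]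
    [IsProbabilityMeasure P] (hP : IsProductOf P ν) {lam : ℝ} (hlam : 0 < lam)
    (u : (Fin d → ℤ) → ℝ) (Λ : Finset (Fin d → ℤ)) (j : Λ) {t : (Fin d → ℤ) → ℝ}
    (ht : (Function.support t).Finite)
    (htpos : ∀ x ∈ Λ, (if x = (j : Fin d → ℤ) then (1 : ℝ) else 0) ≤ ∑' k, t k * u (x - k))
    {ε : ℝ} (hε : 0 < ε) (E : ℝ) :
    ∫⁻ ω, ENNReal.ofReal (imGreen lam u Λ j ε E ω) ∂P ≤
      ENNReal.ofReal (Real.pi / lam / 2 * (∑' k, |t k|) * varNorm ρ) := by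
  have hT := isHermitian_hopping Λ
  have hmeas : Measurable (imGreen lam u Λ j ε E) :=
    measurable_imGreen_energy lam u Λ j hε E
  have h0 : ∀ ω, 0 ≤ imGreen lam u Λ j ε E ω := fun ω =>
    Set.indicator_nonneg (fun ω _ => im_greenDiag_nonneg hT
      (fun x => (im_ofReal_sub_neg hε _ _).2) j) ω
  have hB : ∀ ω, imGreen lam u Λ j ε E ω ≤ ε⁻¹ := fun ω =>
    Set.indicator_apply_le' (fun _ => ((le_abs_self _).trans
      (Complex.abs_im_le_norm _)).trans (norm_greenDiag_le hT hε
        (fun x => (im_ofReal_sub_neg hε _ _).1) j)) fun _ => (inv_pos.mpr hε).le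
  set W : Λ → ℝ := fun x => lam * ∑' k, t k * u (x - k) with hW
  have hW0 : ∀ x, 0 ≤ W x := fun x => mul_nonneg hlam.le
    (le_trans (by split_ifs <;> norm_num) (htpos x x.2))
  have hWj : lam ≤ W j := by
    have := htpos j j.2
    rw [if_pos rfl] at this
    exact le_mul_of_one_le_right hlam.le this
  have hgreen : ∀ ω ∈ convergenceSet u Λ, ∀ r : ℝ, imGreen lam u Λ j ε E (ω + r • t) =
      (greenDiag (hopping Λ) (fun x => (((lam * potential u ω x : ℝ) : ℂ) -
        ((E : ℂ) + ε * Complex.I)) + (r : ℂ) * W x) j).im := by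
    intro ω hω r
    rw [imGreen, Set.indicator_of_mem ((add_smul_mem_convergenceSet_iff ht ω r).mpr hω)]
    congr 3
    ext x
    rw [potential_add_smul ht hω r x, hW]
    push_cast
    ring
  have hzero : ∀ ω ∉ convergenceSet u Λ, ∀ r : ℝ, imGreen lam u Λ j ε E (ω + r • t) = 0 :=
    fun ω hω r => Set.indicator_of_notMem
      (fun h => hω ((add_smul_mem_convergenceSet_iff ht ω r).mp h)) _
  have hcont : ∀ ω, Continuous fun r : ℝ => imGreen lam u Λ j ε E (ω + r • t) := by
    intro ω
    by_cases hω : ω ∈ convergenceSet u Λ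
    · simp only [hgreen ω hω]
      refine Complex.continuous_im.comp (continuous_greenDiag hT
        (v := fun (r : ℝ) (x : Λ) => (((lam * potential u ω x : ℝ) : ℂ) -
          ((E : ℂ) + ε * Complex.I)) + (r : ℂ) * W x) (by fun_prop) (fun r x => ?_) j)
      rw [← Complex.ofReal_mul, Complex.add_im, Complex.ofReal_im, add_zero]
      exact (im_ofReal_sub_neg hε _ _).2
    · simp only [hzero ω hω]
      exact continuous_const
  have hK : 0 < Real.pi / lam := by positivity
  have hline : ∀ ω, ∫⁻ r : ℝ, ENNReal.ofReal (imGreen lam u Λ j ε E (ω + r • t)) ≤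
      ENNReal.ofReal (Real.pi / lam) := by
    intro ω
    by_cases hω : ω ∈ convergenceSet u Λ
    · simp only [hgreen ω hω]
      refine (lintegral_im_greenDiag_le hT hε (fun x => (im_ofReal_sub_neg hε _ _).1) hW0
        (hlam.trans_le hWj)).trans (ENNReal.ofReal_le_ofReal ?_)
      exact div_le_div_of_nonneg_left Real.pi_pos.le hlam hWj
    · simp only [hzero ω hω, ENNReal.ofReal_zero, lintegral_zero, zero_le]
  have hmain := integral_le_of_line_lintegral_le hρ_nonneg hρ_int hρ hν hP hmeas h0 hB ht
    hcont hK hline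
  have hint : Integrable (imGreen lam u Λ j ε E) P := by
    refine Integrable.of_bound hmeas.aestronglyMeasurable ε⁻¹
      (Filter.Eventually.of_forall fun ω => ?_)
    rw [Real.norm_of_nonneg (h0 ω)]
    exact hB ω
  rw [← ofReal_integral_eq_lintegral_ofReal hint (Filter.Eventually.of_forall h0)]
  exact ENNReal.ofReal_le_ofReal hmain

end AlloyType

/-- **Abstract Wegner estimate** (Theorem 4.1). -/
theorem stmt_9 (d : ℕ) (hd : 1 ≤ d) (lam : ℝ) (hlam : 0 < lam)
    (ρ : ℝ → ℝ) (hρ_nonneg : ∀ x, 0 ≤ ρ x) (hρ_int : Integrable ρ)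
    (hρ_bv : BddAbove (varSet ρ))
    (ν : Measure ℝ) (hν : ν = volume.withDensity fun x => ENNReal.ofReal (ρ x))
    [IsProbabilityMeasure ν]
    (hν_supp : ∃ R : ℝ, 0 < R ∧ ν (Set.Icc (-R) R) = 1)
    (P : Measure ((Fin d → ℤ) → ℝ)) [IsProbabilityMeasure P]
    (hP : IsProductOf P ν)
    (u : (Fin d → ℤ) → ℝ) (hu : Summable fun k => |u k|)
    (l : ℕ) (hl : 1 ≤ l)
    (t : (Fin d → ℤ) → (Fin d → ℤ) → ℝ)
    (ht_fin : ∀ j ∈ cube l (0 : Fin d → ℤ), (Function.support (t j)).Finite)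
    (ht_pos : ∀ j ∈ cube l (0 : Fin d → ℤ), ∀ x ∈ cube l (0 : Fin d → ℤ),
      (if x = j then (1 : ℝ) else 0) ≤ ∑' k : Fin d → ℤ, t j k * u (x - k))
    (E1 E2 : ℝ) (hE : E1 ≤ E2) :
    ∫⁻ ω, (eigCount (hamiltonian lam u ω (cube l 0)) (Set.Icc E1 E2) : ℝ≥0∞) ∂P
      ≤ ENNReal.ofReal ((1 / (2 * lam)) * varNorm ρ * (E2 - E1) *
          ∑ j ∈ cube l (0 : Fin d → ℤ), ∑' k : Fin d → ℤ, |t j k|) := by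
  obtain ⟨R, -, hR⟩ := hν_supp
  set Λ : Finset (Fin d → ℤ) := cube l 0
  set V := varNorm ρ
  set S : ℝ := ∑ j ∈ Λ, ∑' k : Fin d → ℤ, |t j k|
  have hV : 0 ≤ V := varNorm_nonneg hρ_bv
  have hconv := ae_mem_convergenceSet hP hR hu Λ
  set N : ℝ≥0∞ := ∫⁻ ω, (eigCount (hamiltonian lam u ω Λ) (Set.Icc E1 E2) : ℝ≥0∞) ∂P
  have hsmooth : ∀ ε η : ℝ, 0 < ε → 0 < η →
      N * ENNReal.ofReal (2 * Real.arctan (η / ε)) ≤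
        ENNReal.ofReal ((E2 - E1 + 2 * η) * (Real.pi / lam / 2 * S * V)) := by
    intro ε η hε hη
    have hjoint : ∀ j : Λ, Measurable fun p : ((Fin d → ℤ) → ℝ) × ℝ =>
        ENNReal.ofReal (imGreen lam u Λ j ε p.2 p.1) := fun j =>
      (measurable_imGreen lam u Λ j hε).ennreal_ofReal
    calc N * ENNReal.ofReal (2 * Real.arctan (η / ε))
        ≤ ∫⁻ ω, (eigCount (hamiltonian lam u ω Λ) (Set.Icc E1 E2) : ℝ≥0∞) *
            ENNReal.ofReal (2 * Real.arctan (η / ε)) ∂P := lintegral_mul_const_le _ _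
      _ ≤ ∫⁻ ω, (∫⁻ E in Set.Ioc (E1 - η) (E2 + η),
            ∑ j : Λ, ENNReal.ofReal (imGreen lam u Λ j ε E ω)) ∂P := by
          refine lintegral_mono_ae ?_
          filter_upwards [hconv] with ω hω
          refine (eigCount_mul_arctan_le (isHermitian_hamiltonian lam u ω Λ) hε hη hE).trans
            (le_of_eq ?_)
          simp only [greenDiag_hamiltonian, imGreen, Set.indicator_of_mem hω]
      _ = ∫⁻ E in Set.Ioc (E1 - η) (E2 + η),
            (∫⁻ ω, ∑ j : Λ, ENNReal.ofReal (imGreen lam u Λ j ε E ω) ∂P) :=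
          lintegral_lintegral_swap
            (Finset.measurable_fun_sum _ fun j _ => hjoint j).aemeasurable
      _ ≤ ∫⁻ _ in Set.Ioc (E1 - η) (E2 + η), ENNReal.ofReal (Real.pi / lam / 2 * S * V) := by
          refine lintegral_mono fun E => ?_
          have hm : ∀ j : Λ, Measurable fun ω => ENNReal.ofReal (imGreen lam u Λ j ε E ω) :=
            fun j => (measurable_imGreen_energy lam u Λ j hε E).ennreal_ofReal
          rw [lintegral_finsetSum _ fun j _ => hm j]
          refine (Finset.sum_le_sum fun j _ => integral_imGreen_le hρ_nonneg hρ_int hρ_bv hν hP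
            hlam u Λ j (ht_fin j j.2) (ht_pos j j.2) hε E).trans (le_of_eq ?_)
          rw [← ENNReal.ofReal_sum_of_nonneg fun j _ => by positivity, ← Finset.sum_mul,
            ← Finset.mul_sum, Finset.sum_coe_sort Λ fun j => ∑' k, |t j k|]
      _ = ENNReal.ofReal ((E2 - E1 + 2 * η) * (Real.pi / lam / 2 * S * V)) := by
          rw [lintegral_const, Measure.restrict_apply_univ, Real.volume_Ioc, mul_comm,
            ← ENNReal.ofReal_mul (by linarith)]
          congr 2
          ring
  have hpi : N * ENNReal.ofReal Real.pi ≤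
      ENNReal.ofReal ((E2 - E1) * (Real.pi / lam / 2 * S * V)) := by
    have hη : Filter.Tendsto (fun η : ℝ => η) (nhdsWithin 0 (Set.Ioi 0)) (nhds 0) :=
      nhdsWithin_le_nhds
    have hleft : Filter.Tendsto
        (fun η : ℝ => N * ENNReal.ofReal (2 * Real.arctan (η / η ^ 2)))
        (nhdsWithin 0 (Set.Ioi 0)) (nhds (N * ENNReal.ofReal (2 * (Real.pi / 2)))) := by
      refine ENNReal.Tendsto.const_mul (ENNReal.tendsto_ofReal (Filter.Tendsto.const_mul 2 ?_))
        (Or.inl (ENNReal.ofReal_pos.mpr (by positivity)).ne')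
      refine (Real.tendsto_arctan_atTop.mono_right nhdsWithin_le_nhds).comp
        (tendsto_inv_nhdsGT_zero.congr' ?_)
      filter_upwards [self_mem_nhdsWithin] with η hη
      have : η ≠ 0 := ne_of_gt hη
      field_simp
    have hright : Filter.Tendsto
        (fun η : ℝ => ENNReal.ofReal ((E2 - E1 + 2 * η) * (Real.pi / lam / 2 * S * V)))
        (nhdsWithin 0 (Set.Ioi 0))
        (nhds (ENNReal.ofReal ((E2 - E1 + 2 * 0) * (Real.pi / lam / 2 * S * V)))) :=
      ENNReal.tendsto_ofReal (((hη.const_mul 2).const_add _).mul_const _)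
    rw [mul_div_cancel₀ _ two_ne_zero] at hleft
    rw [mul_zero, add_zero] at hright
    refine le_of_tendsto_of_tendsto hleft hright ?_
    filter_upwards [self_mem_nhdsWithin] with η hη
    have hη' : 0 < η := hη
    exact hsmooth _ η (by positivity) hη'
  rw [← ENNReal.mul_le_mul_iff_left (ENNReal.ofReal_pos.mpr Real.pi_pos).ne'
    ENNReal.ofReal_ne_top]
  refine hpi.trans (le_of_eq ?_)
  have hS : 0 ≤ S := by positivity
  have hE' : 0 ≤ E2 - E1 := by linarith
  rw [← ENNReal.ofReal_mul (by positivity)]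
  congr 1
  field_simp

end
end

section
/- Exact cancellation for polynomially weighted sums of translates (Proposition 4.6): Let d ≥ 1 and let u : ℤ^d → ℝ satisfy |u(k)| ≤ C e^{−α|k|₁} for all k ∈ ℤ^d, with constants C, α > 0. Suppose I₀ ∈ ℕ₀^d and c_u ≠ 0 satisfy: D^J G(0) = 0 for every J ∈ ℕ₀^d with J ≤ I₀ and J ≠ I₀, and D^{I₀} G(0) = c_u. Then for every multi-index I ∈ ℕ₀^d with I ≤ I₀ and every x ∈ ℤ^d, the absolutely convergent series ∑_{k∈ℤ^d} k^{I} u(x−k) equals 0 if I ≠ I₀, and equals c_u if I = I₀. -/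
noncomputable section

/-- The partial derivative of `f : ℝ^d → ℝ` in the `i`-th coordinate direction. -/
def pderiv' {d : ℕ} (i : Fin d) (f : (Fin d → ℝ) → ℝ) : (Fin d → ℝ) → ℝ :=
  fun x => deriv (fun τ : ℝ => f (Function.update x i τ)) (x i)

/-- The `n`-fold iterated partial derivative in the `i`-th coordinate direction. -/
def iterPDeriv {d : ℕ} (i : Fin d) : ℕ → ((Fin d → ℝ) → ℝ) → ((Fin d → ℝ) → ℝ)
  | 0, f => f
  | n + 1, f => pderiv' i (iterPDeriv i n f)

/-- The mixed partial derivative `D^J f = ∂^{j₁}_{s₁} ⋯ ∂^{j_d}_{s_d} f`. -/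
def mpderiv {d : ℕ} (J : Fin d → ℕ) (f : (Fin d → ℝ) → ℝ) : (Fin d → ℝ) → ℝ :=
  (List.finRange d).foldr (fun i g => iterPDeriv i (J i) g) f

/-- The generating function `G(s) = ∑_{k∈ℤ^d} u(-k) e^{⟨k,s⟩}`. -/
def Gfun {d : ℕ} (u : (Fin d → ℤ) → ℝ) (s : Fin d → ℝ) : ℝ :=
  ∑' k : Fin d → ℤ, u (-k) * Real.exp (∑ r, (k r : ℝ) * s r)

/-- The exponential series `∑_{k∈ℤ^d} w(k) e^{⟨k,s⟩}` with coefficients `w`. -/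
def expSeries {d : ℕ} (w : (Fin d → ℤ) → ℝ) (s : Fin d → ℝ) : ℝ :=
  ∑' k : Fin d → ℤ, w k * Real.exp (∑ r, (k r : ℝ) * s r)

/-- The exponential series with coefficients `w` is summable on the open cube `(-α, α)^d`. -/
def ExpSummable {d : ℕ} (α : ℝ) (w : (Fin d → ℤ) → ℝ) : Prop :=
  ∀ s : Fin d → ℝ, (∀ r, |s r| < α) →
    Summable fun k : Fin d → ℤ => w k * Real.exp (∑ r, (k r : ℝ) * s r)

lemma summable_pi_prod {ι κ : Type*} [Fintype ι] (f : ι → κ → ℝ)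
    (hf₀ : ∀ i n, 0 ≤ f i n) (hf : ∀ i, Summable (f i)) :
    Summable fun k : ι → κ => ∏ i, f i (k i) := by
  classical
  refine summable_of_sum_le (c := ∏ i, ∑' n, f i n)
    (fun k => Finset.prod_nonneg fun i _ => hf₀ i _) fun S => ?_
  calc ∑ k ∈ S, ∏ i, f i (k i)
      ≤ ∑ k ∈ Fintype.piFinset fun i => S.image fun k => k i, ∏ i, f i (k i) := by
        refine Finset.sum_le_sum_of_subset_of_nonneg (fun k hk => ?_)
          fun k _ _ => Finset.prod_nonneg fun i _ => hf₀ i _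
        exact Fintype.mem_piFinset.2 fun i => Finset.mem_image_of_mem _ hk
    _ = ∏ i, ∑ n ∈ S.image fun k => k i, f i n := (Finset.prod_univ_sum _ _).symm
    _ ≤ ∏ i, ∑' n, f i n :=
        Finset.prod_le_prod (fun i _ => Finset.sum_nonneg fun n _ => hf₀ i n)
          fun i _ => (hf i).sum_le_tsum _ fun n _ => hf₀ i n

lemma summable_exp_neg_mul_abs_int {β : ℝ} (hβ : 0 < β) :
    Summable fun n : ℤ => Real.exp (-(β * |(n : ℝ)|)) := by
  have h := Real.summable_exp_nat_mul_iff.2 (neg_lt_zero.2 hβ)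
  refine Summable.of_nat_of_neg ?_ ?_ <;>
  · refine h.congr fun n => ?_
    congr 1
    simp
    ring

lemma dist1_zero_cast {d : ℕ} (k : Fin d → ℤ) : (dist1 k 0 : ℝ) = ∑ r, |(k r : ℝ)| := by
  simp [dist1, Nat.cast_natAbs]

lemma expSummable_of_decay {d : ℕ} {v : (Fin d → ℤ) → ℝ} {C α : ℝ}
    (hv : ∀ k, |v k| ≤ C * Real.exp (-(α * (dist1 k 0 : ℝ)))) : ExpSummable α v := by
  intro s hs
  have key := (summable_pi_prod (fun (r : Fin d) (n : ℤ) => Real.exp (-((α - |s r|) * |(n : ℝ)|)))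
    (fun _ _ => (Real.exp_pos _).le)
    fun r => summable_exp_neg_mul_abs_int (sub_pos.2 (hs r))).mul_left C
  have hC : 0 ≤ C := by
    have h := (abs_nonneg _).trans (hv 0)
    exact nonneg_of_mul_nonneg_left h (Real.exp_pos _)
  refine Summable.of_norm_bounded key fun k => ?_
  rw [norm_mul, Real.norm_eq_abs, Real.norm_eq_abs, Real.abs_exp, ← Real.exp_sum]
  refine (mul_le_mul_of_nonneg_right (hv k) (Real.exp_pos _).le).trans ?_
  rw [mul_assoc, ← Real.exp_add]
  refine mul_le_mul_of_nonneg_left (Real.exp_le_exp.2 ?_) hC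
  rw [dist1_zero_cast, Finset.mul_sum, ← Finset.sum_neg_distrib, ← Finset.sum_add_distrib]
  refine Finset.sum_le_sum fun r _ => ?_
  have h : (k r : ℝ) * s r ≤ |(k r : ℝ)| * |s r| := (le_abs_self _).trans (abs_mul _ _).le
  linarith

lemma sum_mul_update {d : ℕ} (a s : Fin d → ℝ) (i : Fin d) (t : ℝ) :
    ∑ r, a r * Function.update s i t r = ∑ r, a r * s r + a i * (t - s i) := by
  rw [← sub_eq_iff_eq_add', ← Finset.sum_sub_distrib, Finset.sum_eq_single i]
  · simp [mul_sub]
  · intro r _ hr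
    simp [hr]
  · simp

lemma abs_update_lt {d : ℕ} {α : ℝ} {s : Fin d → ℝ} (hs : ∀ r, |s r| < α) (i : Fin d) {t : ℝ}
    (ht : |t| < α) (r : Fin d) : |Function.update s i t r| < α := by
  rcases eq_or_ne r i with rfl | hr
  · simpa using ht
  · simpa [hr] using hs r

lemma exists_abs_add_lt {α a : ℝ} (ha : |a| < α) :
    ∃ ε > 0, |a + ε| < α ∧ |a - ε| < α := by
  obtain ⟨h₁, h₂⟩ := abs_lt.1 ha
  refine ⟨(α - |a|) / 2, by linarith, ?_, ?_⟩ <;>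
  · rw [abs_lt]
    have := le_abs_self a
    have := neg_abs_le a
    constructor <;> linarith

lemma exp_mul_le_exp_add_exp {a ε t : ℝ} (ht : |t| ≤ ε) :
    Real.exp (a * t) ≤ Real.exp (a * ε) + Real.exp (a * -ε) := by
  obtain ⟨h₁, h₂⟩ := abs_le.1 ht
  rcases le_total 0 a with ha | ha
  · have := Real.exp_le_exp.2 (mul_le_mul_of_nonneg_left h₂ ha)
    have := Real.exp_pos (a * -ε)
    linarith
  · have := Real.exp_le_exp.2 (mul_le_mul_of_nonpos_left h₁ ha)
    have := Real.exp_pos (a * ε)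
    linarith

lemma abs_mul_le_exp_add_exp (a : ℝ) {ε : ℝ} (hε : 0 < ε) :
    |a| ≤ ε⁻¹ * (Real.exp (a * ε) + Real.exp (a * -ε)) := by
  rw [← div_eq_inv_mul, le_div_iff₀ hε]
  have h₁ := Real.add_one_le_exp (a * ε)
  have h₂ := Real.add_one_le_exp (a * -ε)
  have h₃ := Real.exp_pos (a * ε)
  have h₄ := Real.exp_pos (a * -ε)
  rcases abs_cases a with ⟨h, _⟩ | ⟨h, _⟩ <;> rw [h] <;> linarith

lemma ExpSummable.summable_shift {d : ℕ} {α : ℝ} {w : (Fin d → ℤ) → ℝ} (hw : ExpSummable α w)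
    {s : Fin d → ℝ} (hs : ∀ r, |s r| < α) (i : Fin d) {ε : ℝ}
    (h₁ : |s i + ε| < α) (h₂ : |s i - ε| < α) :
    Summable fun k : Fin d → ℤ => |w k| * Real.exp (∑ r, (k r : ℝ) * s r) *
      (Real.exp (k i * ε) + Real.exp (k i * -ε)) := by
  have a₁ := (hw _ (abs_update_lt hs i h₁)).abs
  have a₂ := (hw _ (abs_update_lt hs i h₂)).abs
  refine (a₁.add a₂).congr fun k => ?_
  rw [sum_mul_update, sum_mul_update, abs_mul, abs_mul, Real.abs_exp, Real.abs_exp,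
    Real.exp_add, Real.exp_add]
  ring_nf

lemma ExpSummable.mul_coord {d : ℕ} {α : ℝ} {w : (Fin d → ℤ) → ℝ} (hw : ExpSummable α w)
    (i : Fin d) : ExpSummable α fun k => (k i : ℝ) * w k := by
  intro s hs
  obtain ⟨ε, hε, h₁, h₂⟩ := exists_abs_add_lt (hs i)
  refine Summable.of_norm_bounded ((hw.summable_shift hs i h₁ h₂).mul_left ε⁻¹) fun k => ?_
  rw [Real.norm_eq_abs, abs_mul, abs_mul, Real.abs_exp, mul_assoc]
  refine (mul_le_mul_of_nonneg_right (abs_mul_le_exp_add_exp (k i : ℝ) hε)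
    (by positivity)).trans_eq ?_
  ring

lemma ExpSummable.hasDerivAt {d : ℕ} {α : ℝ} {w : (Fin d → ℤ) → ℝ} (hw : ExpSummable α w)
    {s : Fin d → ℝ} (hs : ∀ r, |s r| < α) (i : Fin d) :
    HasDerivAt (fun t => expSeries w (Function.update s i t))
      (expSeries (fun k => (k i : ℝ) * w k) s) (s i) := by
  obtain ⟨ε, hε, h₁, h₂⟩ := exists_abs_add_lt (hs i)
  have hmem : s i ∈ Metric.ball (s i) ε := Metric.mem_ball_self hε
  have h := hasDerivAt_tsum_of_isPreconnected
    (g := fun (k : Fin d → ℤ) t => w k * Real.exp (∑ r, (k r : ℝ) * Function.update s i t r))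
    (g' := fun (k : Fin d → ℤ) t =>
      (k i : ℝ) * w k * Real.exp (∑ r, (k r : ℝ) * Function.update s i t r))
    ((hw.mul_coord i).summable_shift hs i h₁ h₂) Metric.isOpen_ball
    (convex_ball (s i) ε).isPreconnected ?_ ?_ hmem ?_ hmem
  · simp only [Function.update_eq_self] at h
    exact h
  · intro k t _
    simp only [sum_mul_update (fun r => (k r : ℝ))]
    have h := ((((hasDerivAt_id t).sub_const (s i)).const_mul (k i : ℝ)).const_add
      (∑ r, (k r : ℝ) * s r)).exp.const_mul (w k)
    refine h.congr_deriv ?_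
    simp only [id]
    ring
  · intro k t ht
    rw [sum_mul_update (fun r => (k r : ℝ)), Real.norm_eq_abs, abs_mul, Real.abs_exp,
      Real.exp_add, ← mul_assoc]
    refine mul_le_mul_of_nonneg_left (exp_mul_le_exp_add_exp ?_) (by positivity)
    exact (Real.dist_eq t (s i) ▸ Metric.mem_ball.1 ht).le
  · simpa only [Function.update_eq_self] using hw s hs

lemma pderiv'_congr {d : ℕ} {α : ℝ} {f g : (Fin d → ℝ) → ℝ}
    (hfg : ∀ s, (∀ r, |s r| < α) → f s = g s) (i : Fin d) {s : Fin d → ℝ}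
    (hs : ∀ r, |s r| < α) : pderiv' i f s = pderiv' i g s := by
  refine Filter.EventuallyEq.deriv_eq ?_
  filter_upwards [(isOpen_lt continuous_abs continuous_const).mem_nhds (hs i)] with t ht
  exact hfg _ (abs_update_lt hs i ht)

lemma ExpSummable.mul_coord_pow {d : ℕ} {α : ℝ} {w : (Fin d → ℤ) → ℝ} (hw : ExpSummable α w)
    (i : Fin d) (n : ℕ) : ExpSummable α fun k => (k i : ℝ) ^ n * w k := by
  induction n with
  | zero => simpa using hw
  | succ n ih => simpa only [pow_succ', mul_assoc] using ih.mul_coord i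

lemma iterPDeriv_eq_expSeries {d : ℕ} {α : ℝ} {w : (Fin d → ℤ) → ℝ} (hw : ExpSummable α w)
    {f : (Fin d → ℝ) → ℝ} (hf : ∀ s, (∀ r, |s r| < α) → f s = expSeries w s)
    (i : Fin d) (n : ℕ) {s : Fin d → ℝ} (hs : ∀ r, |s r| < α) :
    iterPDeriv i n f s = expSeries (fun k => (k i : ℝ) ^ n * w k) s := by
  induction n generalizing s with
  | zero => simpa [iterPDeriv] using hf s hs
  | succ n ih =>
    rw [iterPDeriv, pderiv'_congr (fun s hs => ih hs) i hs]
    simpa only [pderiv', pow_succ', mul_assoc] using ((hw.mul_coord_pow i n).hasDerivAt hs i).deriv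

lemma foldr_iterPDeriv_expSeries {d : ℕ} {α : ℝ} {w : (Fin d → ℤ) → ℝ} (hw : ExpSummable α w)
    (J : Fin d → ℕ) (l : List (Fin d)) :
    (ExpSummable α fun k => (l.map fun i => (k i : ℝ) ^ J i).prod * w k) ∧
    ∀ s : Fin d → ℝ, (∀ r, |s r| < α) →
      l.foldr (fun i g => iterPDeriv i (J i) g) (expSeries w) s =
        expSeries (fun k => (l.map fun i => (k i : ℝ) ^ J i).prod * w k) s := by
  induction l with
  | nil => simpa using hw
  | cons i l ih =>
    simp only [List.map_cons, List.prod_cons, List.foldr_cons, mul_assoc]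
    exact ⟨ih.1.mul_coord_pow i (J i),
      fun s hs => iterPDeriv_eq_expSeries ih.1 ih.2 i (J i) hs⟩

lemma ExpSummable.hasSum_moment {d : ℕ} {α : ℝ} (hα : 0 < α) {w : (Fin d → ℤ) → ℝ}
    (hw : ExpSummable α w) (J : Fin d → ℕ) :
    HasSum (fun k : Fin d → ℤ => (∏ r, (k r : ℝ) ^ J r) * w k)
      (mpderiv J (expSeries w) 0) := by
  obtain ⟨h₁, h₂⟩ := foldr_iterPDeriv_expSeries hw J (List.finRange d)
  have h₀ : ∀ r : Fin d, |(0 : Fin d → ℝ) r| < α := by simpa using fun _ => hα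
  have hsum := (h₁ 0 h₀).hasSum
  rw [mpderiv, h₂ 0 h₀]
  simpa [expSeries, Fin.prod_univ_def] using hsum

lemma prod_add_pow {d : ℕ} (a b : Fin d → ℝ) (I : Fin d → ℕ) :
    ∏ r, (a r + b r) ^ I r = ∑ J ∈ Fintype.piFinset fun r => Finset.range (I r + 1),
      (∏ r, b r ^ (I r - J r) * (I r).choose (J r)) * ∏ r, a r ^ J r := by
  simp only [add_pow, Finset.prod_univ_sum, ← Finset.prod_mul_distrib]
  refine Finset.sum_congr rfl fun J _ => Finset.prod_congr rfl fun r _ => ?_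
  ring

/-- **Exact cancellation for polynomially weighted sums of translates** (Proposition 4.6). -/
theorem stmt_11 (d : ℕ) (hd : 1 ≤ d) (u : (Fin d → ℤ) → ℝ)
    (Cdec α : ℝ) (hCdec : 0 < Cdec) (hα : 0 < α)
    (hu_decay : ∀ k : Fin d → ℤ, |u k| ≤ Cdec * Real.exp (-(α * (dist1 k 0 : ℝ))))
    (I₀ : Fin d → ℕ) (cu : ℝ) (hcu : cu ≠ 0)
    (hD1 : ∀ J : Fin d → ℕ, (∀ r, J r ≤ I₀ r) → J ≠ I₀ →
      mpderiv J (Gfun u) (0 : Fin d → ℝ) = 0)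
    (hD2 : mpderiv I₀ (Gfun u) (0 : Fin d → ℝ) = cu) :
    ∀ I : Fin d → ℕ, (∀ r, I r ≤ I₀ r) → ∀ x : Fin d → ℤ,
      Summable (fun k : Fin d → ℤ => (∏ r, ((k r : ℝ)) ^ I r) * u (x - k)) ∧
      (∑' k : Fin d → ℤ, (∏ r, ((k r : ℝ)) ^ I r) * u (x - k)) =
        (if I = I₀ then cu else 0) := by
  have hw : ExpSummable α fun k : Fin d → ℤ => u (-k) :=
    expSummable_of_decay (C := Cdec) fun k => by simpa [dist1] using hu_decay (-k)
  intro I hI x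
  set c : (Fin d → ℕ) → ℝ :=
    fun J => ∏ r, (x r : ℝ) ^ (I r - J r) * ((I r).choose (J r) : ℝ) with hc
  have hval : ∑ J ∈ Fintype.piFinset (fun r => Finset.range (I r + 1)),
      c J * mpderiv J (Gfun u) 0 = if I = I₀ then cu else 0 := by
    rw [Finset.sum_eq_single I]
    · split_ifs with h
      · subst h
        simp [hc, hD2]
      · rw [hD1 I hI h, mul_zero]
    · intro J hJ hJI
      have hle : ∀ r, J r ≤ I r := fun r =>
        Nat.lt_succ_iff.1 (Finset.mem_range.1 (Fintype.mem_piFinset.1 hJ r))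
      rw [hD1 J (fun r => (hle r).trans (hI r)), mul_zero]
      rintro rfl
      exact hJI (funext fun r => (hle r).antisymm (hI r))
    · intro h
      exact absurd (Fintype.mem_piFinset.2 fun r => Finset.mem_range.2 (Nat.lt_succ_self _)) h
  have hsum : HasSum (fun m : Fin d → ℤ => (∏ r, ((m r : ℝ) + x r) ^ I r) * u (-m))
      (if I = I₀ then cu else 0) := by
    rw [← hval]
    convert! hasSum_sum fun J _ => (hw.hasSum_moment hα J).mul_left (c J) using 2 with m
    rw [prod_add_pow, Finset.sum_mul]
    simp only [hc, mul_assoc]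
  have hshift : HasSum (fun k : Fin d → ℤ => (∏ r, (k r : ℝ) ^ I r) * u (x - k))
      (if I = I₀ then cu else 0) := by
    rw [← (Equiv.addRight x).hasSum_iff]
    simpa [Function.comp_def] using hsum
  exact ⟨hshift.summable, hshift.tsum_eq⟩


end
end
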